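/- Let $m \geq 1$, $n \geq 2$, and integers $i_1,\dots,i_m \geq 0$ with $|i| := i_1+\cdots+i_m \leq n$. For any convex bodies $A, B_1,\dots,B_m, K_1,\dots,K_{n-|i|}$ in $\mathbb{R}^n$: $\frac{n!}{i_1!\cdots i_m!(n-|i|)!} |A|^m V(B_1[i_1],\dots,B_m[i_m],K_1,\dots,K_{n-|i|}) \leq \binom{n}{|i|} V(K_1,\dots,K_{n-|i|},A[|i|]) \prod_{k=1}^m \binom{n}{i_k} V(B_k[i_k], A[n-i_k])$. -/

import Mathlib

open scoped Pointwise
open MeasureTheory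

/-- A convex body in `ℝⁿ`: a compact convex set with nonempty interior. -/
def IsConvexBody {n : ℕ} (K : Set (EuclideanSpace ℝ (Fin n))) : Prop :=
  Convex ℝ K ∧ IsCompact K ∧ (interior K).Nonempty

/-- The mixed volume of `n` convex bodies in `ℝⁿ`, via the
inclusion-exclusion (polarization) formula for Minkowski sums. -/
noncomputable def mixedVolume {n : ℕ} (K : Fin n → Set (EuclideanSpace ℝ (Fin n))) : ℝ :=
  ((n.factorial : ℝ))⁻¹ *
    ∑ S : Finset (Fin n), (-1 : ℝ) ^ (n + S.card) * (volume (∑ i ∈ S, K i)).toReal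

/-- The list `B 0` repeated `i 0` times, then `B 1` repeated `i 1` times, etc. -/
def blocks {α : Type*} {m : ℕ} (i : Fin m → ℕ) (B : Fin m → α) : List α :=
  (List.ofFn fun k => List.replicate (i k) (B k)).flatten


section Algebra
open Matrix
open scoped MatrixOrder ComplexOrder

variable {ι : Type*} [Fintype ι] [DecidableEq ι]

/-- polarization of the determinant -/
noncomputable def mdisc (P : ι → Matrix ι ι ℝ) : ℝ :=
  ∑ S : Finset ι, (-1 : ℝ) ^ (Fintype.card ι + S.card) * (∑ j ∈ S, P j).det

/-- mixed discriminant (times factorial) -/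
noncomputable def ydisc (P : ι → Matrix ι ι ℝ) : ℝ :=
  ∑ σ : Equiv.Perm ι, (Matrix.of fun i => P (σ i) i).det

theorem sum_superset_sign (T : Finset ι) :
    ∑ S : Finset ι, (if T ⊆ S then (-1 : ℝ) ^ (Fintype.card ι + S.card) else 0)
      = if T = Finset.univ then 1 else 0 := by
  rw [← Finset.sum_filter]
  have : ∑ S ∈ Finset.univ.filter (fun S => T ⊆ S), (-1 : ℝ) ^ (Fintype.card ι + S.card)
      = ∑ U ∈ (Tᶜ).powerset, (-1 : ℝ) ^ U.card := by
    refine Finset.sum_nbij' (fun S => Sᶜ) (fun U => Uᶜ) ?_ ?_ ?_ ?_ ?_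
    · intro S hS; simp at hS ⊢; exact hS
    · intro S hS; simp at hS ⊢; intro x hx; simp; intro h; have := hS h; simp at this; exact this hx
    · intro S _; simp
    · intro S _; simp
    · intro S _
      rw [Finset.card_compl]
      have : S.card ≤ Fintype.card ι := Finset.card_le_univ S
      have e : Fintype.card ι + S.card = (Fintype.card ι - S.card) + 2 * S.card := by omega
      rw [e, pow_add, pow_mul]; simp
  rw [this]
  have h2 := Finset.sum_powerset_neg_one_pow_card (x := Tᶜ)
  have h3 : ((∑ U ∈ (Tᶜ).powerset, (-1 : ℤ) ^ U.card : ℤ) : ℝ) = ∑ U ∈ (Tᶜ).powerset, (-1 : ℝ) ^ U.card := by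
    push_cast; rfl
  rw [← h3, h2]
  by_cases h : T = Finset.univ
  · simp [h]
  · have : Tᶜ ≠ ∅ := by simpa [Finset.compl_eq_empty_iff] using h
    simp [h]

theorem mdisc_eq_ydisc (P : ι → Matrix ι ι ℝ) : mdisc P = ydisc P := by
  unfold mdisc ydisc
  have h1 : ∀ S : Finset ι, (∑ j ∈ S, P j).det =
      ∑ f : ι → ι, if Finset.univ.image f ⊆ S then (Matrix.of fun i => P (f i) i).det else 0 := by
    intro S
    have := (detRowAlternating (n := ι) (R := ℝ)).toMultilinearMap.map_sum_finset
      (fun (i : ι) (j : ι) => (P j) i) (fun _ => S)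
    have e : (∑ j ∈ S, P j).det = (detRowAlternating (n := ι) (R := ℝ)).toMultilinearMap
      (fun i => ∑ j ∈ S, P j i) := by
      change _ = Matrix.det _
      congr 1
      ext i k
      rw [Matrix.sum_apply]
      simp
    rw [e, this, ← Finset.sum_filter]
    refine Finset.sum_congr ?_ ?_
    · ext f; simp [Fintype.mem_piFinset, Finset.image_subset_iff]
    · intro f _; rfl
  simp_rw [h1, Finset.mul_sum]
  rw [Finset.sum_comm]
  have h2 : ∀ f : ι → ι, ∑ S : Finset ι, ((-1 : ℝ) ^ (Fintype.card ι + S.card) *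
      (if Finset.univ.image f ⊆ S then (Matrix.of fun i => P (f i) i).det else 0)) =
      if Function.Bijective f then (Matrix.of fun i => P (f i) i).det else 0 := by
    intro f
    have := sum_superset_sign (Finset.univ.image f)
    have h3 : (Finset.univ.image f = Finset.univ) ↔ Function.Bijective f := by
      rw [← Finite.surjective_iff_bijective]
      constructor
      · intro h x
        have : x ∈ Finset.univ.image f := by rw [h]; exact Finset.mem_univ x
        simpa using this
      · exact Finset.image_univ_of_surjective
    rw [if_congr h3 rfl rfl] at this
    have h4 : (if Function.Bijective f then (Matrix.of fun i => P (f i) i).det else 0) =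
      (if Function.Bijective f then 1 else 0) * (Matrix.of fun i => P (f i) i).det := by
      split_ifs <;> simp
    rw [h4, ← this, Finset.sum_mul]
    refine Finset.sum_congr rfl fun S _ => ?_
    split_ifs <;> simp
  simp_rw [h2]
  rw [← Finset.sum_filter]
  symm
  refine Finset.sum_bij (fun σ _ => (σ : ι → ι)) ?_ ?_ ?_ ?_
  · intro σ _; exact Finset.mem_filter.2 ⟨Finset.mem_univ _, σ.bijective⟩
  · intro σ _ τ _ h; exact Equiv.coe_fn_injective h
  · intro f hf
    have hf := (Finset.mem_filter.1 hf).2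
    exact ⟨Equiv.ofBijective f hf, Finset.mem_univ _, rfl⟩
  · intro σ _; rfl

theorem ydisc_update_aux (P : ι → Matrix ι ι ℝ) (j : ι) (z : Matrix ι ι ℝ) (σ : Equiv.Perm ι) :
    (Matrix.of fun i => (Function.update P j z) (σ i) i) =
        Matrix.updateRow (Matrix.of fun i => P (σ i) i) (σ.symm j) (z (σ.symm j)) := by
  ext a b
  by_cases h : a = σ.symm j
  · subst h; simp
  · have : σ a ≠ j := fun h' => h (by simp [← h'])
    simp [Matrix.updateRow_ne h, Function.update_of_ne this]

/-- The multilinear map behind `ydisc`. -/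
noncomputable def ymul : MultilinearMap ℝ (fun _ : ι => Matrix ι ι ℝ) ℝ :=
  MultilinearMap.mk' ydisc
  (by
    intro P j x y
    unfold ydisc
    rw [← Finset.sum_add_distrib]
    refine Finset.sum_congr rfl fun σ _ => ?_
    rw [ydisc_update_aux, ydisc_update_aux, ydisc_update_aux, ← Matrix.det_updateRow_add]; rfl)
  (by
    intro P j c x
    unfold ydisc
    rw [Finset.smul_sum]
    refine Finset.sum_congr rfl fun σ _ => ?_
    rw [ydisc_update_aux, ydisc_update_aux, smul_eq_mul, ← Matrix.det_updateRow_smul]; rfl)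

theorem ymul_apply (P : ι → Matrix ι ι ℝ) : ymul P = ydisc P := rfl

theorem ydisc_rank_one (v : ι → ι → ℝ) :
    ydisc (fun j => vecMulVec (v j) (v j)) = (Matrix.of v).det ^ 2 := by
  unfold ydisc
  have : ∀ σ : Equiv.Perm ι, (Matrix.of fun i => vecMulVec (v (σ i)) (v (σ i)) i).det =
      (Equiv.Perm.sign σ * ∏ i, v (σ i) i) * (Matrix.of v).det := by
    intro σ
    have e : (Matrix.of fun i => vecMulVec (v (σ i)) (v (σ i)) i) =
      Matrix.of (fun i j => v (σ i) i * (((Matrix.of v).submatrix σ id) i j)) := by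
      ext i j; simp [vecMulVec_apply]
    rw [e, Matrix.det_mul_column, Matrix.det_permute]
    ring
  simp_rw [this]
  rw [← Finset.sum_mul, sq]
  congr 1
  rw [Matrix.det_apply']
  simp

theorem ydisc_congr_mul (N : Matrix ι ι ℝ) (P : ι → Matrix ι ι ℝ) :
    ydisc (fun j => N * P j * Nᵀ) = N.det ^ 2 * ydisc P := by
  rw [← mdisc_eq_ydisc, ← mdisc_eq_ydisc]
  unfold mdisc
  rw [Finset.mul_sum]
  refine Finset.sum_congr rfl fun S _ => ?_
  rw [← Finset.sum_mul, ← Finset.mul_sum, det_mul, det_mul, det_transpose]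
  ring

theorem psd_rank_one {P : Matrix ι ι ℝ} (hP : P.PosSemidef) :
    ∃ v : ι → ι → ℝ, P = ∑ a, vecMulVec (v a) (v a) := by
  obtain ⟨Q, hQ⟩ := CStarAlgebra.nonneg_iff_eq_star_mul_self.mp hP.nonneg
  refine ⟨fun a => Q a, ?_⟩
  rw [hQ]
  ext i j
  simp [Matrix.mul_apply, Matrix.sum_apply, vecMulVec_apply]

theorem multilinear_psd_nonneg (Λ : MultilinearMap ℝ (fun _ : ι => Matrix ι ι ℝ) ℝ)
    (h : ∀ v : ι → ι → ℝ, 0 ≤ Λ (fun j => vecMulVec (v j) (v j)))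
    (P : ι → Matrix ι ι ℝ) (hP : ∀ j, (P j).PosSemidef) : 0 ≤ Λ P := by
  choose v hv using fun j => psd_rank_one (hP j)
  have : P = fun j => ∑ a, vecMulVec (v j a) (v j a) := funext hv
  rw [this, Λ.map_sum]
  exact Finset.sum_nonneg fun r _ => h (fun j => v j (r j))

theorem ydisc_nonneg (P : ι → Matrix ι ι ℝ) (hP : ∀ j, (P j).PosSemidef) : 0 ≤ ydisc P := by
  rw [← ymul_apply]
  refine multilinear_psd_nonneg _ (fun v => ?_) P hP
  rw [ymul_apply, ydisc_rank_one]; positivity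

theorem det_le_one_of_trace {P : Matrix ι ι ℝ} (hP : P.PosSemidef)
    (ht : P.trace = Fintype.card ι) : P.det ≤ 1 := by
  have h1 := hP.1.det_eq_prod_eigenvalues
  have h2 := hP.1.trace_eq_sum_eigenvalues
  simp only [RCLike.ofReal_real_eq_id, id_eq] at h1 h2
  rw [h1]
  calc ∏ i, hP.1.eigenvalues i ≤ ∏ i, Real.exp (hP.1.eigenvalues i - 1) := by
        refine Finset.prod_le_prod (fun i _ => hP.eigenvalues_nonneg i) (fun i _ => ?_)
        have := Real.add_one_le_exp (hP.1.eigenvalues i - 1)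
        linarith
    _ = 1 := by
        rw [← Real.exp_sum, Finset.sum_sub_distrib, ← h2, ht]; simp

/-- Fischer inequality for several blocks -/
theorem fischer {κ : Type*} [Fintype κ] [LinearOrder κ] (γ : ι → κ) {N : Matrix ι ι ℝ}
    (hN : N.PosDef) : N.det ≤ ∏ k, (N.toSquareBlock γ k).det := by
  set B : Matrix ι ι ℝ := Matrix.of fun i j => if γ i = γ j then N i j else 0 with hB
  have hBt : B.BlockTriangular γ := by
    intro i j h; simp [hB, h.ne']
  have hBt' : B.BlockTriangular (fun i => OrderDual.toDual (γ i)) := by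
    intro i j h
    have : γ i < γ j := h
    simp [hB, this.ne]
  have hdet : B.det = ∏ k, (N.toSquareBlock γ k).det := by
    rw [hBt.det_fintype]
    refine Finset.prod_congr rfl fun k _ => ?_
    congr 1
    ext i j
    simp [hB, toSquareBlock_def, i.2, j.2]
  have hpos : 0 < B.det := by
    rw [hdet]
    refine Finset.prod_pos fun k _ => ?_
    exact (hN.submatrix (e := fun i : {i // γ i = k} => (i : ι)) Subtype.val_injective).det_pos
  have hBpsd : B.PosSemidef := by
    have : B = ∑ k, (Matrix.diagonal fun i => if γ i = k then (1 : ℝ) else 0)ᴴ * N *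
        (Matrix.diagonal fun i => if γ i = k then (1 : ℝ) else 0) := by
      ext i j
      simp only [hB, Matrix.of_apply, Matrix.sum_apply, Matrix.diagonal_conjTranspose,
        Matrix.mul_diagonal, Matrix.diagonal_mul]
      rw [Finset.sum_eq_single (γ i)]
      · by_cases h : γ i = γ j <;> simp [h, eq_comm]
      · intro b _ hb; simp [hb.symm]
      · simp
    rw [this]
    exact posSemidef_sum _ fun k _ => hN.posSemidef.conjTranspose_mul_mul_same _
  have hu : IsUnit B.det := hpos.ne'.isUnit
  letI : Invertible B := B.invertibleOfIsUnitDet hu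
  have hW1 := blockTriangular_inv_of_blockTriangular hBt
  have hW2 := blockTriangular_inv_of_blockTriangular hBt'
  have hW : ∀ i j, γ i ≠ γ j → B⁻¹ i j = 0 := by
    intro i j h
    rcases lt_or_gt_of_ne h with h | h
    · exact hW2 h
    · exact hW1 h
  have htr : (B⁻¹ * N).trace = Fintype.card ι := by
    have : (B⁻¹ * N).trace = (B⁻¹ * B).trace := by
      simp only [Matrix.trace, Matrix.diag_apply, Matrix.mul_apply]
      refine Finset.sum_congr rfl fun i _ => Finset.sum_congr rfl fun j _ => ?_
      by_cases h : γ j = γ i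
      · simp [hB, h]
      · rw [hW i j (Ne.symm h)]; simp
    rw [this, Matrix.nonsing_inv_mul _ hu, Matrix.trace_one]
  obtain ⟨Q, hQ⟩ := CStarAlgebra.nonneg_iff_eq_star_mul_self.mp hBpsd.inv.nonneg
  have hQ' : B⁻¹ = Qᴴ * Q := hQ
  have h1 : (Q * N * Qᴴ).det ≤ 1 := by
    refine det_le_one_of_trace (hN.posSemidef.mul_mul_conjTranspose_same Q) ?_
    rw [Matrix.trace_mul_comm, ← Matrix.mul_assoc, ← hQ', htr]
  have h2 : (Q * N * Qᴴ).det = B.det⁻¹ * N.det := by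
    have : B⁻¹.det = B.det⁻¹ := by
      have := Matrix.det_nonsing_inv B
      rw [this, Ring.inverse_eq_inv']
    rw [← this, hQ', det_mul, det_mul, det_mul]; ring
  rw [h2] at h1
  rw [← hdet]
  rwa [inv_mul_le_one₀ hpos] at h1

/-- `M` with the rows of a set replaced by the rows of the identity. -/
noncomputable def rowId (p : ι → Prop) [DecidablePred p] (M : Matrix ι ι ℝ) : Matrix ι ι ℝ :=
  Matrix.of fun i => if p i then (1 : Matrix ι ι ℝ) i else M i

theorem det_rowId_not (p : ι → Prop) [DecidablePred p] (N : Matrix ι ι ℝ) :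
    (rowId (fun i => ¬ p i) N).det = (N.toSquareBlockProp p).det := by
  rw [Matrix.twoBlockTriangular_det _ p]
  · have h1 : (rowId (fun i => ¬ p i) N).toSquareBlockProp p = N.toSquareBlockProp p := by
      ext i j; simp [rowId, Matrix.toSquareBlockProp_def, i.2]
    have h2 : (rowId (fun i => ¬ p i) N).toSquareBlockProp (fun i => ¬ p i) = 1 := by
      ext i j; simp [rowId, Matrix.toSquareBlockProp_def, i.2, Matrix.one_apply, Subtype.ext_iff]
    rw [h1, h2, det_one, mul_one]
  · intro i hi j hj
    have : i ≠ j := fun h => hi (h ▸ hj)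
    simp [rowId, hi, this]

theorem rowId_mul_inv (p : ι → Prop) [DecidablePred p] {M : Matrix ι ι ℝ} (hM : IsUnit M.det) :
    rowId p M * M⁻¹ = rowId (fun i => ¬ p i) M⁻¹ := by
  ext i j
  by_cases h : p i
  · have : (rowId p M * M⁻¹) i j = ((1 : Matrix ι ι ℝ) * M⁻¹) i j := by
      simp [Matrix.mul_apply, rowId, h]
    rw [this]; simp [rowId, h]
  · have : (rowId p M * M⁻¹) i j = (M * M⁻¹) i j := by
      simp [Matrix.mul_apply, rowId, h]
    rw [this, Matrix.mul_nonsing_inv _ hM]; simp [rowId, h]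

theorem fischer_rowId {κ : Type*} [Fintype κ] [LinearOrder κ] [Nonempty κ] (γ : ι → κ)
    {M : Matrix ι ι ℝ} (hM : M.PosDef) :
    M.det ^ (Fintype.card κ - 1) ≤ ∏ k, (rowId (fun i => γ i = k) M).det := by
  have hu : IsUnit M.det := hM.det_pos.ne'.isUnit
  have h1 : ∀ k, (rowId (fun i => γ i = k) M).det = M.det * (M⁻¹.toSquareBlock γ k).det := by
    intro k
    have := congrArg Matrix.det (rowId_mul_inv (fun i => γ i = k) hu)
    rw [det_rowId_not, det_mul, Matrix.det_nonsing_inv, Ring.inverse_eq_inv'] at this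
    have h3 := hM.det_pos.ne'
    field_simp at this
    rw [this]; rfl
  simp_rw [h1]
  rw [Finset.prod_mul_distrib, Finset.prod_const, Finset.card_univ]
  have h2 := fischer γ hM.inv
  rw [Matrix.det_nonsing_inv, Ring.inverse_eq_inv'] at h2
  have hc : Fintype.card κ = (Fintype.card κ - 1) + 1 := by
    have := Fintype.card_pos (α := κ); omega
  calc M.det ^ (Fintype.card κ - 1) = M.det ^ (Fintype.card κ) * M.det⁻¹ := by
        conv_rhs => rw [hc, pow_succ]
        rw [mul_assoc, mul_inv_cancel₀ hM.det_pos.ne', mul_one]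
    _ ≤ _ := mul_le_mul_of_nonneg_left h2 (pow_nonneg hM.det_pos.le _)

theorem ydisc_std (p : ι → Prop) [DecidablePred p] (M : Matrix ι ι ℝ) :
    ydisc (fun j => if p j then vecMulVec (Pi.single j 1) (Pi.single j 1) else M) =
      ((Fintype.card ι - Fintype.card {i // p i}).factorial : ℝ) * (rowId p M).det := by
  unfold ydisc
  have h1 : ∀ σ : Equiv.Perm ι, (Matrix.of fun i => (if p (σ i) then
      vecMulVec (Pi.single (σ i) 1 : ι → ℝ) (Pi.single (σ i) 1) else M) i).det =
      if (∀ i, p i → σ i = i) then (rowId p M).det else 0 := by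
    intro σ
    split_ifs with h
    · congr 1
      ext i j
      by_cases hi : p i
      · simp [rowId, h i hi, hi, vecMulVec_apply, Matrix.one_apply, Pi.single_apply, eq_comm]
      · have : ¬ p (σ i) := by
          intro h'
          have := h _ h'
          have := σ.injective this
          rw [this] at h'; exact hi h'
        simp [rowId, this, hi]
    · push Not at h
      obtain ⟨i, hi, hne⟩ := h
      refine Matrix.det_eq_zero_of_row_eq_zero (σ.symm i) fun j => ?_
      have : σ.symm i ≠ i := fun h => hne ((Equiv.symm_apply_eq σ).1 h).symm
      simp [hi, vecMulVec_apply, this]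
  rw [Finset.sum_congr rfl fun σ _ => h1 σ, ← Finset.sum_filter, Finset.sum_const, nsmul_eq_mul]
  congr 2
  have e := Equiv.Perm.subtypeEquivSubtypePerm (fun i => ¬ p i)
  have h2 := Fintype.card_congr e
  rw [Fintype.card_perm, Fintype.card_subtype_compl] at h2
  rw [h2, Fintype.card_subtype]
  congr 1
  ext σ
  simp

theorem ydisc_pointwise {κ : Type*} [Fintype κ] [LinearOrder κ] [Nonempty κ] (γ : ι → κ)
    (hκ : 2 ≤ Fintype.card κ)
    (P : ι → Matrix ι ι ℝ) (hP : ∀ j, (P j).PosSemidef) (M : Matrix ι ι ℝ) (hM : M.PosSemidef) :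
    ydisc P * M.det ^ (Fintype.card κ - 1) ≤
      ∏ k, (ydisc (fun j => if γ j = k then P j else M) /
        ((Fintype.card ι - Fintype.card {i // γ i = k}).factorial : ℝ)) := by
  have hnn : ∀ (P : ι → Matrix ι ι ℝ) (_ : ∀ j, (P j).PosSemidef), 0 ≤
      ∏ k, (ydisc (fun j => if γ j = k then P j else M) /
        ((Fintype.card ι - Fintype.card {i // γ i = k}).factorial : ℝ)) := by
    intro P hP
    refine Finset.prod_nonneg fun k _ => div_nonneg (ydisc_nonneg _ fun j => ?_) (by positivity)
    split_ifs; exacts [hP j, hM]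
  by_cases hd : M.det = 0
  · rw [hd, zero_pow (by omega), mul_zero]; exact hnn P hP
  have hMd : M.PosDef := by
    refine hM.posDef_iff_isUnit.2 ?_
    exact (Matrix.isUnit_iff_isUnit_det _).2 (Ne.isUnit hd)
  set c : κ → ℝ := fun k => ((Fintype.card ι - Fintype.card {i // γ i = k}).factorial : ℝ) with hc
  have hcpos : ∀ k, 0 < c k := fun k => by simp only [hc]; positivity
  have key : ∀ (P : ι → Matrix ι ι ℝ) (j : ι) (z : Matrix ι ι ℝ) (k : κ),
      (fun j' => if γ j' = k then Function.update P j z j' else M) =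
      if γ j = k then Function.update (fun j' => if γ j' = k then P j' else M) j z
      else (fun j' => if γ j' = k then P j' else M) := by
    intro P j z k
    funext j'
    by_cases h : j' = j
    · subst h; by_cases h2 : γ j' = k <;> simp [h2]
    · by_cases h2 : γ j = k <;> simp [h, h2]
  have key2 : ∀ (P : ι → Matrix ι ι ℝ) (j : ι) (z : Matrix ι ι ℝ),
      ∏ k, (ydisc (fun j' => if γ j' = k then Function.update P j z j' else M) / c k) =
      ymul (Function.update (fun j' => if γ j' = γ j then P j' else M) j z) / c (γ j) *
        ∏ k ∈ Finset.univ.erase (γ j), (ydisc (fun j' => if γ j' = k then P j' else M) / c k) := by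
    intro P j z
    rw [← Finset.mul_prod_erase _ _ (Finset.mem_univ (γ j))]
    congr 1
    · rw [key, if_pos rfl, ymul_apply]
    · refine Finset.prod_congr rfl fun k hk => ?_
      rw [key, if_neg (Finset.ne_of_mem_erase hk).symm]
  let Λ : MultilinearMap ℝ (fun _ : ι => Matrix ι ι ℝ) ℝ := MultilinearMap.mk'
    (fun P => ∏ k, (ydisc (fun j => if γ j = k then P j else M) / c k))
    (by
      intro P j x y
      rw [key2, key2, key2, MultilinearMap.map_update_add]; ring)
    (by
      intro P j a x
      rw [key2, key2, MultilinearMap.map_update_smul, smul_eq_mul, smul_eq_mul]; ring)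
  let Λ' : MultilinearMap ℝ (fun _ : ι => Matrix ι ι ℝ) ℝ := Λ - (M.det ^ (Fintype.card κ - 1)) •
    (ymul : MultilinearMap ℝ (fun _ : ι => Matrix ι ι ℝ) ℝ)
  have main : 0 ≤ Λ' P := by
    refine multilinear_psd_nonneg _ (fun v => ?_) P hP
    have hv : ∀ j, (vecMulVec (v j) (v j)).PosSemidef := fun j => by
      simpa using posSemidef_vecMulVec_self_star (v j)
    change 0 ≤ (∏ k, (ydisc (fun j => if γ j = k then vecMulVec (v j) (v j) else M) / c k)) -
      M.det ^ (Fintype.card κ - 1) * ydisc (fun j => vecMulVec (v j) (v j))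
    rw [ydisc_rank_one, sub_nonneg]
    by_cases hv0 : (Matrix.of v).det = 0
    · rw [hv0]; simpa using hnn _ hv
    set W : Matrix ι ι ℝ := (Matrix.of v)ᵀ with hW
    have hWd : W.det = (Matrix.of v).det := Matrix.det_transpose _
    have hWu : IsUnit W.det := by rw [hWd]; exact Ne.isUnit hv0
    set M' : Matrix ι ι ℝ := W⁻¹ * M * W⁻¹ᵀ with hM'
    have hM'd : M'.PosDef := by
      have := hMd.mul_mul_conjTranspose_same (B := W⁻¹) (by
        rw [Matrix.vecMul_injective_iff_isUnit, Matrix.isUnit_nonsing_inv_iff,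
          Matrix.isUnit_iff_isUnit_det]
        exact hWu)
      simpa using this
    have hMM' : M = W * M' * Wᵀ := by
      have e1 : W * W⁻¹ = 1 := Matrix.mul_nonsing_inv _ hWu
      have e2 : W⁻¹ᵀ * Wᵀ = 1 := by rw [← Matrix.transpose_mul, e1, Matrix.transpose_one]
      rw [hM']
      calc M = 1 * M * 1 := by simp
        _ = (W * W⁻¹) * M * (W⁻¹ᵀ * Wᵀ) := by rw [e1, e2]
        _ = _ := by simp only [Matrix.mul_assoc]
    have hvv : ∀ j, vecMulVec (v j) (v j) =
        W * vecMulVec (Pi.single j 1) (Pi.single j 1) * Wᵀ := by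
      intro j
      rw [Matrix.mul_vecMulVec, Matrix.vecMulVec_mul]
      congr 1
      · ext i; simp [hW]
      · ext i; simp [hW]
    have hk : ∀ k, ydisc (fun j => if γ j = k then vecMulVec (v j) (v j) else M) / c k =
        W.det ^ 2 * (rowId (fun i => γ i = k) M').det := by
      intro k
      have : (fun j => if γ j = k then vecMulVec (v j) (v j) else M) = fun j => W *
          (if γ j = k then vecMulVec (Pi.single j 1) (Pi.single j 1) else M') * Wᵀ := by
        funext j
        split_ifs
        · exact hvv j
        · exact hMM'
      rw [this, ydisc_congr_mul, ydisc_std (fun j => γ j = k)]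
      have := (hcpos k).ne'
      simp only [hc] at this ⊢
      field_simp
    simp_rw [hk]
    rw [Finset.prod_mul_distrib, Finset.prod_const, Finset.card_univ, ← hWd]
    have hdM : M.det = W.det ^ 2 * M'.det := by
      have := congrArg Matrix.det hMM'
      rw [det_mul, det_mul, det_transpose W] at this
      linear_combination this
    have hcard : Fintype.card κ = (Fintype.card κ - 1) + 1 := by omega
    calc M.det ^ (Fintype.card κ - 1) * W.det ^ 2
        = (W.det ^ 2) ^ Fintype.card κ * M'.det ^ (Fintype.card κ - 1) := by
          obtain ⟨q, hq⟩ : ∃ q, Fintype.card κ = q + 1 := ⟨_, hcard⟩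
          rw [hdM, mul_pow, hq, Nat.add_sub_cancel, pow_succ (W.det ^ 2) q]
          ring
      _ ≤ _ := mul_le_mul_of_nonneg_left (fischer_rowId γ hM'd) (by positivity)
  have e : Λ' P =
    (∏ k, (ydisc (fun j => if γ j = k then P j else M) / c k)) -
      M.det ^ (Fintype.card κ - 1) * ydisc P := rfl
  rw [e] at main
  linarith

theorem ydisc_mono (P Q : ι → Matrix ι ι ℝ) (hQ : ∀ j, (Q j).PosSemidef)
    (h : ∀ j, (P j - Q j).PosSemidef) : ydisc Q ≤ ydisc P := by
  have hP : ∀ j, (P j).PosSemidef := fun j => by simpa using (h j).add (hQ j)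
  have main : ∀ s : Finset ι, ydisc Q ≤ ydisc (fun j => if j ∈ s then P j else Q j) := by
    intro s
    induction s using Finset.induction_on with
    | empty => simp
    | insert a s ha ih =>
      refine ih.trans ?_
      set F : ι → Matrix ι ι ℝ := fun j => if j ∈ s then P j else Q j with hF
      have e1 : (fun j => if j ∈ insert a s then P j else Q j) =
          Function.update F a (Q a + (P a - Q a)) := by
        funext j
        by_cases hj : j = a
        · subst hj; simp
        · simp [hj, hF]
      have e2 : F = Function.update F a (Q a) := by
        funext j
        by_cases hj : j = a
        · subst hj; simp [hF, ha]
        · simp [hj]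
      rw [e1, ← ymul_apply, ← ymul_apply, MultilinearMap.map_update_add, ← e2]
      have : 0 ≤ ydisc (Function.update F a (P a - Q a)) := by
        refine ydisc_nonneg _ fun j => ?_
        by_cases hj : j = a
        · subst hj; simpa using h j
        · simp only [Function.update_of_ne hj, hF]
          split_ifs
          exacts [hP j, hQ j]
      rw [ymul_apply (Function.update F a (P a - Q a))]
      linarith
  simpa using main Finset.univ

theorem ydisc_one_pos : 0 < ydisc (fun _ : ι => (1 : Matrix ι ι ℝ)) := by
  unfold ydisc
  have : (Matrix.of fun i => (1 : Matrix ι ι ℝ) i) = 1 := rfl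
  simp only [this, det_one]
  simp [Fintype.card_perm, Nat.factorial_pos]

theorem posDef_sub_smul_one {P : Matrix ι ι ℝ} (hP : P.PosDef) :
    ∃ ε : ℝ, 0 < ε ∧ ∀ δ ≤ ε, 0 ≤ δ → (P - δ • (1 : Matrix ι ι ℝ)).PosSemidef := by
  rcases isEmpty_or_nonempty ι with hι | hι
  · refine ⟨1, one_pos, fun δ _ _ => ?_⟩
    rw [Subsingleton.elim (P - δ • (1 : Matrix ι ι ℝ)) 0]
    exact PosSemidef.zero
  obtain ⟨i0, hi0⟩ := Finite.exists_min hP.isHermitian.eigenvalues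
  refine ⟨hP.isHermitian.eigenvalues i0, hP.eigenvalues_pos i0, fun δ hδ _ => ?_⟩
  have hs := hP.isHermitian.spectral_theorem
  set U := hP.isHermitian.eigenvectorUnitary with hU
  have h1 : P - δ • (1 : Matrix ι ι ℝ) = (U : Matrix ι ι ℝ) *
      (diagonal (fun i => hP.isHermitian.eigenvalues i - δ)) * (U : Matrix ι ι ℝ)ᴴ := by
    have e : diagonal (fun i => hP.isHermitian.eigenvalues i - δ) =
      diagonal (hP.isHermitian.eigenvalues) - δ • (1 : Matrix ι ι ℝ) := by
      ext i j
      by_cases hij : i = j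
      · subst hij; simp
      · simp [hij]
    have hUU : (U : Matrix ι ι ℝ) * (U : Matrix ι ι ℝ)ᴴ = 1 := Unitary.coe_mul_star_self U
    rw [e, Matrix.mul_sub, Matrix.sub_mul, Matrix.mul_smul, Matrix.smul_mul, Matrix.mul_one, hUU]
    congr 1
  rw [h1]
  exact (PosSemidef.diagonal fun i => sub_nonneg.2 (hδ.trans (hi0 i))).mul_mul_conjTranspose_same _

theorem ydisc_pos (P : ι → Matrix ι ι ℝ) (hP : ∀ j, (P j).PosDef) : 0 < ydisc P := by
  choose ε hε h using fun j => posDef_sub_smul_one (hP j)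
  obtain ⟨δ, hδ, hle⟩ : ∃ δ : ℝ, 0 < δ ∧ ∀ j, δ ≤ ε j := by
    rcases isEmpty_or_nonempty ι with hι | hι
    · exact ⟨1, one_pos, fun j => hι.elim j⟩
    · obtain ⟨j, hj⟩ := Finite.exists_min ε
      exact ⟨ε j, hε j, hj⟩
  have h1 : 0 < ydisc (fun _ : ι => δ • (1 : Matrix ι ι ℝ)) := by
    have := ymul.map_smul_univ (fun _ : ι => δ) (fun _ : ι => (1 : Matrix ι ι ℝ))
    rw [ymul_apply, ymul_apply] at this
    rw [this]
    have := ydisc_one_pos (ι := ι)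
    simp only [Finset.prod_const, smul_eq_mul]
    positivity
  exact h1.trans_le (ydisc_mono _ _ (fun j => PosSemidef.one.smul hδ.le)
    fun j => h j δ (hle j) hδ.le)

end Algebra

section Potentials
open Matrix Filter Topology
open scoped RealInnerProductSpace NNReal ENNReal

theorem volume_image_lipschitz_le {n : ℕ} {C : ℝ≥0}
    {f : EuclideanSpace ℝ (Fin n) → EuclideanSpace ℝ (Fin n)} {s : Set (EuclideanSpace ℝ (Fin n))}
    (hf : LipschitzOnWith C f s) : volume (f '' s) ≤ (C : ℝ≥0∞) ^ n * volume s := by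
  have : (μH[(Module.finrank ℝ (EuclideanSpace ℝ (Fin n)) : ℝ)] :
    Measure (EuclideanSpace ℝ (Fin n))).IsAddHaarMeasure := isAddHaarMeasure_hausdorffMeasure
  have h1 := Measure.isAddLeftInvariant_eq_smul (volume : Measure (EuclideanSpace ℝ (Fin n)))
    (μH[(Module.finrank ℝ (EuclideanSpace ℝ (Fin n)) : ℝ)])
  have h2 := hf.hausdorffMeasure_image_le
    (d := (Module.finrank ℝ (EuclideanSpace ℝ (Fin n)) : ℝ)) (by positivity)
  rw [h1]
  simp only [Measure.smul_apply, ENNReal.smul_def, smul_eq_mul]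
  refine (mul_le_mul_right h2 _).trans (le_of_eq ?_)
  have e : (C : ℝ≥0∞) ^ ((Module.finrank ℝ (EuclideanSpace ℝ (Fin n)) : ℕ) : ℝ) = (C : ℝ≥0∞) ^ n := by
    simp
  rw [e]
  ring

/-- `φ` is a convex potential whose gradient `G` parametrizes the open convex set `O`. -/
structure IsPot {n : ℕ} (O : Set (EuclideanSpace ℝ (Fin n))) (φ : EuclideanSpace ℝ (Fin n) → ℝ)
    (G : EuclideanSpace ℝ (Fin n) → EuclideanSpace ℝ (Fin n)) : Prop where
  isOpen : IsOpen O
  convex : Convex ℝ O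
  grad : ∀ x, HasFDerivAt φ (innerSL ℝ (G x)) x
  mem : ∀ x, G x ∈ closure O
  mono : ∀ x y, 0 ≤ ⟪G x - G y, x - y⟫
  lip : ∃ C : ℝ≥0, LipschitzWith C G
  coer : ∀ p ∈ O, Tendsto (fun x => φ x - ⟪p, x⟫) (cocompact _) atTop

variable {n : ℕ} {O O' : Set (EuclideanSpace ℝ (Fin n))} {φ ψ : EuclideanSpace ℝ (Fin n) → ℝ}
  {G H : EuclideanSpace ℝ (Fin n) → EuclideanSpace ℝ (Fin n)}

theorem IsPot.add (h : IsPot O φ G) (h' : IsPot O' ψ H) :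
    IsPot (O + O') (fun x => φ x + ψ x) (fun x => G x + H x) where
  isOpen := h.isOpen.add_right
  convex := h.convex.add h'.convex
  grad x := by
    rw [map_add]; exact (h.grad x).add (h'.grad x)
  mem x := by
    have : closure O + closure O' ⊆ closure (O + O') := by
      rintro _ ⟨a, ha, b, hb, rfl⟩
      exact map_mem_closure₂ continuous_add ha hb fun a ha b hb => Set.add_mem_add ha hb
    exact this (Set.add_mem_add (h.mem x) (h'.mem x))
  mono x y := by
    have := h.mono x y
    have := h'.mono x y
    have e : G x + H x - (G y + H y) = (G x - G y) + (H x - H y) := by abel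
    rw [e, inner_add_left]; linarith
  lip := by
    obtain ⟨C, hC⟩ := h.lip
    obtain ⟨C', hC'⟩ := h'.lip
    exact ⟨C + C', hC.add hC'⟩
  coer := by
    rintro _ ⟨p, hp, q, hq, rfl⟩
    refine ((h.coer p hp).atTop_add_atTop (h'.coer q hq)).congr fun x => ?_
    simp only [inner_add_left]; ring

theorem IsPot.sum {ι : Type*} {O : ι → Set (EuclideanSpace ℝ (Fin n))}
    {φ : ι → EuclideanSpace ℝ (Fin n) → ℝ}
    {G : ι → EuclideanSpace ℝ (Fin n) → EuclideanSpace ℝ (Fin n)}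
    (h : ∀ i, IsPot (O i) (φ i) (G i)) {S : Finset ι} (hS : S.Nonempty) :
    IsPot (∑ i ∈ S, O i) (fun x => ∑ i ∈ S, φ i x) (fun x => ∑ i ∈ S, G i x) := by
  induction hS using Finset.Nonempty.cons_induction with
  | singleton a => simpa using h a
  | cons a s has hs ih =>
    simp only [Finset.sum_cons]
    exact (h a).add ih

theorem IsPot.continuous (h : IsPot O φ G) : Continuous G := by
  obtain ⟨C, hC⟩ := h.lip; exact hC.continuous

theorem IsPot.symm (h : IsPot O φ G) {x : EuclideanSpace ℝ (Fin n)} (hx : DifferentiableAt ℝ G x)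
    (v w : EuclideanSpace ℝ (Fin n)) : ⟪fderiv ℝ G x v, w⟫ = ⟪fderiv ℝ G x w, v⟫ := by
  have h1 : HasFDerivAt (fun y => innerSL ℝ (G y)) ((innerSL ℝ (E := EuclideanSpace ℝ (Fin n))) ∘L
      fderiv ℝ G x) x :=
    ((innerSL ℝ (E := EuclideanSpace ℝ (Fin n))).hasFDerivAt).comp x hx.hasFDerivAt
  exact second_derivative_symmetric h.grad h1 v w

theorem IsPot.psd (h : IsPot O φ G) {x : EuclideanSpace ℝ (Fin n)} (hx : DifferentiableAt ℝ G x)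
    (v : EuclideanSpace ℝ (Fin n)) : 0 ≤ ⟪fderiv ℝ G x v, v⟫ := by
  have h1 : HasDerivAt (fun t : ℝ => G (x + t • v)) (fderiv ℝ G x v) 0 := by
    have h2 : HasDerivAt (fun t : ℝ => x + t • v) v 0 := by
      simpa using ((hasDerivAt_id (0 : ℝ)).smul_const v).const_add x
    have h3 : HasFDerivAt G (fderiv ℝ G x) (x + (0 : ℝ) • v) := by simpa using hx.hasFDerivAt
    exact h3.comp_hasDerivAt (0 : ℝ) h2
  have h4 : Tendsto (fun t : ℝ => t⁻¹ • (G (x + (0 + t) • v) - G (x + (0 : ℝ) • v))) (𝓝[>] 0)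
      (𝓝 (fderiv ℝ G x v)) := (hasDerivAt_iff_tendsto_slope_zero.1 h1).mono_left
        (nhdsWithin_mono _ (by intro t ht; exact ne_of_gt ht))
  refine ge_of_tendsto (h4.inner tendsto_const_nhds) ?_
  filter_upwards [self_mem_nhdsWithin] with t ht
  have ht : 0 < t := ht
  have := h.mono (x + t • v) x
  simp only [zero_add, zero_smul, add_zero, inner_smul_left]
  rw [add_sub_cancel_left, inner_smul_right] at this
  have h5 : 0 ≤ ⟪G (x + t • v) - G x, v⟫ := nonneg_of_mul_nonneg_right this ht
  simp only [conj_trivial]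
  positivity

/-- Jacobian matrix -/
noncomputable def Hm (G : EuclideanSpace ℝ (Fin n) → EuclideanSpace ℝ (Fin n))
    (x : EuclideanSpace ℝ (Fin n)) : Matrix (Fin n) (Fin n) ℝ :=
  LinearMap.toMatrix (EuclideanSpace.basisFun (Fin n) ℝ).toBasis
    (EuclideanSpace.basisFun (Fin n) ℝ).toBasis (fderiv ℝ G x).toLinearMap

theorem Hm_det (x : EuclideanSpace ℝ (Fin n)) : (Hm G x).det = (fderiv ℝ G x).det := by
  unfold Hm; rw [LinearMap.det_toMatrix]

theorem Hm_apply (x : EuclideanSpace ℝ (Fin n)) (i j : Fin n) :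
    Hm G x i j = ⟪EuclideanSpace.single i (1:ℝ), fderiv ℝ G x (EuclideanSpace.single j 1)⟫ := by
  unfold Hm; simp [LinearMap.toMatrix_apply, EuclideanSpace.inner_single_left]

theorem Hm_measurable (i j : Fin n) : Measurable fun x => Hm G x i j := by
  simp only [Hm_apply]
  exact (measurable_const.inner ((measurable_fderiv ℝ G).apply_continuousLinearMap _))

theorem Hm_mulVec (x : EuclideanSpace ℝ (Fin n)) (v : Fin n → ℝ) :
    Hm G x *ᵥ v = (fderiv ℝ G x (WithLp.toLp 2 v)).ofLp := by
  have := LinearMap.toMatrix_mulVec_repr (EuclideanSpace.basisFun (Fin n) ℝ).toBasis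
    (EuclideanSpace.basisFun (Fin n) ℝ).toBasis (fderiv ℝ G x).toLinearMap (WithLp.toLp 2 v)
  have e1 : ((EuclideanSpace.basisFun (Fin n) ℝ).toBasis.repr (WithLp.toLp 2 v) : Fin n → ℝ) = v := by
    funext i; simp
  rw [e1] at this
  funext i
  have := congrFun this i
  simpa [Hm] using this

theorem Hm_quad (x : EuclideanSpace ℝ (Fin n)) (v : Fin n → ℝ) :
    star v ⬝ᵥ (Hm G x *ᵥ v) = ⟪fderiv ℝ G x (WithLp.toLp 2 v), WithLp.toLp 2 v⟫ := by
  rw [Hm_mulVec]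
  simp [PiLp.inner_apply, dotProduct]

theorem IsPot.Hm_psd (h : IsPot O φ G) {x : EuclideanSpace ℝ (Fin n)}
    (hx : DifferentiableAt ℝ G x) : (Hm G x).PosSemidef := by
  refine PosSemidef.of_dotProduct_mulVec_nonneg ?_ ?_
  · ext i j
    simp only [conjTranspose_apply, Hm_apply, star_trivial]
    rw [real_inner_comm, h.symm hx, real_inner_comm]
  · intro v
    rw [Hm_quad]
    exact h.psd hx _

theorem IsPot.ae_diff (h : IsPot O φ G) : ∀ᵐ x, DifferentiableAt ℝ G x := by
  obtain ⟨C, hC⟩ := h.lip; exact hC.ae_differentiableAt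

theorem IsPot.injOn (h : IsPot O φ G) :
    Set.InjOn G {x | DifferentiableAt ℝ G x ∧ (fderiv ℝ G x).det ≠ 0} := by
  rintro x ⟨hx, hd⟩ y - hxy
  by_contra hne
  set v := y - x with hv
  have hv0 : v ≠ 0 := sub_ne_zero.2 (Ne.symm hne)
  have hz : ∀ t : ℝ, 0 < t → t < 1 → ⟪G (x + t • v) - G x, v⟫ = 0 := by
    intro t ht ht1
    have h1 := h.mono (x + t • v) x
    have h2 := h.mono (x + t • v) y
    rw [add_sub_cancel_left, inner_smul_right] at h1
    have e : x + t • v - y = (t - 1) • v := by rw [hv]; module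
    rw [e, ← hxy, inner_smul_right] at h2
    have h3 : 0 ≤ ⟪G (x + t • v) - G x, v⟫ := nonneg_of_mul_nonneg_right h1 ht
    nlinarith
  have hq : ⟪fderiv ℝ G x v, v⟫ = 0 := by
    have h1 : HasDerivAt (fun t : ℝ => G (x + t • v)) (fderiv ℝ G x v) 0 := by
      have h2 : HasDerivAt (fun t : ℝ => x + t • v) v 0 := by
        simpa using ((hasDerivAt_id (0 : ℝ)).smul_const v).const_add x
      have h3 : HasFDerivAt G (fderiv ℝ G x) (x + (0 : ℝ) • v) := by simpa using hx.hasFDerivAt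
      exact h3.comp_hasDerivAt (0 : ℝ) h2
    have h4 : Tendsto (fun t : ℝ => t⁻¹ • (G (x + (0 + t) • v) - G (x + (0 : ℝ) • v))) (𝓝[>] 0)
        (𝓝 (fderiv ℝ G x v)) := (hasDerivAt_iff_tendsto_slope_zero.1 h1).mono_left
          (nhdsWithin_mono _ (by intro t ht; exact ne_of_gt ht))
    refine tendsto_nhds_unique (h4.inner (tendsto_const_nhds (x := v))) ?_
    refine tendsto_const_nhds.congr' ?_
    filter_upwards [Ioo_mem_nhdsGT (zero_lt_one' ℝ)] with t ht
    have := hz t ht.1 ht.2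
    simp [inner_smul_left, this]
  have h5 := (h.Hm_psd hx).dotProduct_mulVec_zero_iff v.ofLp
  rw [Hm_quad] at h5
  have h6 := h5.1 hq
  have h7 := Matrix.eq_zero_of_mulVec_eq_zero (by rw [Hm_det]; exact hd) h6
  apply hv0
  ext i
  exact congrFun h7 i

theorem IsPot.subset_range (h : IsPot O φ G) : O ⊆ Set.range G := by
  intro p hp
  have hd : ∀ x, HasFDerivAt (fun x => φ x - ⟪p, x⟫) (innerSL ℝ (G x) - innerSL ℝ p) x :=
    fun x => (h.grad x).sub (innerSL ℝ p).hasFDerivAt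
  have hc : Continuous (fun x => φ x - ⟪p, x⟫) :=
    continuous_iff_continuousAt.2 fun x => (hd x).continuousAt
  obtain ⟨x, hx⟩ := hc.exists_forall_le (h.coer p hp)
  refine ⟨x, ?_⟩
  have hmin : IsLocalMin (fun x => φ x - ⟪p, x⟫) x := Filter.Eventually.of_forall hx
  have h0 := hmin.hasFDerivAt_eq_zero (hd x)
  have h1 := congrArg (fun T => T (G x - p)) h0
  simp only [_root_.sub_apply, innerSL_apply_apply, _root_.zero_apply] at h1
  rw [← inner_sub_left, inner_self_eq_zero, sub_eq_zero] at h1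
  exact h1

theorem IsPot.area (h : IsPot O φ G) :
    ∫⁻ x, ENNReal.ofReal (Hm G x).det = volume (closure O) := by
  obtain ⟨C, hC⟩ := h.lip
  set N : Set (EuclideanSpace ℝ (Fin n)) := {x | DifferentiableAt ℝ G x} with hN
  have hNm : MeasurableSet N := measurableSet_of_differentiableAt ℝ G
  have hN0 : volume Nᶜ = 0 := hC.ae_differentiableAt
  have hdet : ∀ x ∈ N, (Hm G x).det = |(fderiv ℝ G x).det| := fun x hx => by
    rw [← Hm_det, abs_of_nonneg (h.Hm_psd hx).det_nonneg]
  have hIntg : ∫⁻ x, ENNReal.ofReal (Hm G x).det =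
      ∫⁻ x in N, ENNReal.ofReal |(fderiv ℝ G x).det| := by
    rw [← lintegral_add_compl _ hNm, Measure.restrict_eq_zero.2 hN0]
    simp only [lintegral_zero_measure, add_zero]
    exact setLIntegral_congr_fun hNm fun x hx => by simp only [hdet x hx]
  have hOc : volume (closure O) ≤ volume O := by
    calc volume (closure O) ≤ volume (O ∪ frontier O) := by
          rw [← closure_eq_self_union_frontier]
      _ ≤ volume O + volume (frontier O) := measure_union_le _ _
      _ = volume O := by rw [h.convex.addHaar_frontier volume, add_zero]
  rw [hIntg]
  apply le_antisymm
  · set N' : Set (EuclideanSpace ℝ (Fin n)) :=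
      {x | DifferentiableAt ℝ G x ∧ (fderiv ℝ G x).det ≠ 0} with hN'
    have hmd : Measurable fun x => (fderiv ℝ G x).det :=
      ContinuousLinearMap.continuous_det.measurable.comp (measurable_fderiv ℝ G)
    have hN'm : MeasurableSet N' := hNm.inter (hmd (measurableSet_singleton (0:ℝ)).compl)
    have e : ∫⁻ x in N, ENNReal.ofReal |(fderiv ℝ G x).det| =
        ∫⁻ x in N', ENNReal.ofReal |(fderiv ℝ G x).det| := by
      rw [← lintegral_indicator hNm, ← lintegral_indicator hN'm]
      congr 1
      funext x
      by_cases hx : DifferentiableAt ℝ G x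
      · by_cases hx2 : (fderiv ℝ G x).det = 0
        · simp [Set.indicator, hN', hN, hx, hx2]
        · simp [Set.indicator, hN', hN, hx, hx2]
      · simp [Set.indicator, hN', hN, hx]
    rw [e, lintegral_abs_det_fderiv_eq_addHaar_image volume hN'm
      (fun x hx => hx.1.hasFDerivAt.hasFDerivWithinAt) h.injOn]
    refine measure_mono ?_
    rintro _ ⟨x, -, rfl⟩
    exact h.mem x
  · refine hOc.trans ?_
    have h1 : O ⊆ G '' N ∪ G '' Nᶜ := by
      rw [← Set.image_union, Set.union_compl_self, Set.image_univ]; exact h.subset_range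
    have h2 : volume (G '' Nᶜ) = 0 := by
      have := volume_image_lipschitz_le (hC.lipschitzOnWith (s := Nᶜ))
      rw [hN0, mul_zero] at this
      exact le_antisymm this bot_le
    calc volume O ≤ volume (G '' N) + volume (G '' Nᶜ) := (measure_mono h1).trans (measure_union_le _ _)
      _ = volume (G '' N) := by rw [h2, add_zero]
      _ ≤ _ := addHaar_image_le_lintegral_abs_det_fderiv volume hNm
        (fun x hx => DifferentiableAt.hasFDerivAt hx |>.hasFDerivWithinAt)

theorem Hm_sum {ι : Type*} {G : ι → EuclideanSpace ℝ (Fin n) → EuclideanSpace ℝ (Fin n)}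
    {S : Finset ι} {x : EuclideanSpace ℝ (Fin n)} (h : ∀ i ∈ S, DifferentiableAt ℝ (G i) x) :
    Hm (fun x => ∑ i ∈ S, G i x) x = ∑ i ∈ S, Hm (G i) x := by
  unfold Hm
  rw [fderiv_fun_sum h, ← map_sum]
  congr 1
  ext v
  simp

theorem pot_sum_det (hn : 1 ≤ n) {K : Fin n → Set (EuclideanSpace ℝ (Fin n))}
    (hK : ∀ i, IsConvexBody (K i)) {φ : Fin n → EuclideanSpace ℝ (Fin n) → ℝ}
    {G : Fin n → EuclideanSpace ℝ (Fin n) → EuclideanSpace ℝ (Fin n)}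
    (h : ∀ i, IsPot (interior (K i)) (φ i) (G i)) (S : Finset (Fin n)) :
    Integrable (fun x => (∑ i ∈ S, Hm (G i) x).det) ∧
      ∫ x, (∑ i ∈ S, Hm (G i) x).det = (volume (∑ i ∈ S, K i)).toReal := by
  haveI : Nonempty (Fin n) := ⟨⟨0, hn⟩⟩
  rcases S.eq_empty_or_nonempty with rfl | hS
  · simp only [Finset.sum_empty, det_zero]
    refine ⟨integrable_zero _ _ _, ?_⟩
    have : volume (0 : Set (EuclideanSpace ℝ (Fin n))) = 0 := by
      rw [← Set.singleton_zero]
      haveI : Nontrivial (EuclideanSpace ℝ (Fin n)) := inferInstance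
      exact measure_singleton _
    simp [this]
  have hp := IsPot.sum h hS
  have hae : ∀ᵐ x, ∀ i, DifferentiableAt ℝ (G i) x := ae_all_iff.2 fun i => (h i).ae_diff
  have hpsd : ∀ᵐ x, 0 ≤ (∑ i ∈ S, Hm (G i) x).det := by
    filter_upwards [hae] with x hx
    exact (posSemidef_sum S fun i _ => (h i).Hm_psd (hx i)).det_nonneg
  have hmeas : Measurable (fun x => (∑ i ∈ S, Hm (G i) x).det) := by
    simp only [det_apply, Matrix.sum_apply]
    refine Finset.measurable_sum _ fun σ _ => Measurable.const_smul ?_ _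
    refine Finset.measurable_prod _ fun i _ => Finset.measurable_sum _ fun j _ => ?_
    exact Hm_measurable _ _
  have hlin : ∫⁻ x, ENNReal.ofReal ((∑ i ∈ S, Hm (G i) x).det) = volume (∑ i ∈ S, K i) := by
    have h1 : ∫⁻ x, ENNReal.ofReal ((∑ i ∈ S, Hm (G i) x).det) =
        volume (closure (∑ i ∈ S, interior (K i))) := by
      rw [← hp.area]
      refine lintegral_congr_ae ?_
      filter_upwards [hae] with x hx
      rw [Hm_sum fun i _ => hx i]
    rw [h1]
    have hcl : ∀ i, K i ⊆ closure (interior (K i)) := fun i => by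
      rw [(hK i).1.closure_interior_eq_closure_of_nonempty_interior (hK i).2.2]
      exact subset_closure
    have hcomp : IsCompact (∑ i ∈ S, K i) := by
      clear hp hpsd hmeas h1
      induction hS using Finset.Nonempty.cons_induction with
      | singleton a => simpa using (hK a).2.1
      | cons a s has hs ih => rw [Finset.sum_cons]; exact (hK a).2.1.add ih
    apply le_antisymm
    · refine measure_mono (closure_minimal ?_ hcomp.isClosed)
      exact Set.finset_sum_subset_finset_sum _ _ _ fun i _ => interior_subset
    · refine measure_mono ?_
      have : ∀ i, closure (interior (K i)) = closure (interior (K i)) := fun _ => rfl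
      refine (Set.finset_sum_subset_finset_sum _ _ _ fun i _ => hcl i).trans ?_
      clear hp hpsd hmeas h1 hcomp
      induction hS using Finset.Nonempty.cons_induction with
      | singleton a => simp
      | cons a s has hs ih =>
        rw [Finset.sum_cons, Finset.sum_cons]
        refine (Set.add_subset_add subset_rfl ih).trans ?_
        rintro _ ⟨a, ha, b, hb, rfl⟩
        exact map_mem_closure₂ continuous_add ha hb fun a ha b hb => Set.add_mem_add ha hb
  have hfin : volume (∑ i ∈ S, K i) ≠ ⊤ := by
    have hcomp : IsCompact (∑ i ∈ S, K i) := by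
      clear hp hpsd hmeas hlin
      induction hS using Finset.Nonempty.cons_induction with
      | singleton a => simpa using (hK a).2.1
      | cons a s has hs ih => rw [Finset.sum_cons]; exact (hK a).2.1.add ih
    exact hcomp.measure_lt_top.ne
  constructor
  · refine ⟨hmeas.aestronglyMeasurable, ?_⟩
    rw [hasFiniteIntegral_iff_ofReal hpsd, hlin]
    exact lt_top_iff_ne_top.2 hfin
  · rw [integral_eq_lintegral_of_nonneg_ae hpsd hmeas.aestronglyMeasurable, hlin]

theorem ydisc_Hm_integral (hn : 1 ≤ n) {K : Fin n → Set (EuclideanSpace ℝ (Fin n))}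
    (hK : ∀ i, IsConvexBody (K i)) {φ : Fin n → EuclideanSpace ℝ (Fin n) → ℝ}
    {G : Fin n → EuclideanSpace ℝ (Fin n) → EuclideanSpace ℝ (Fin n)}
    (h : ∀ i, IsPot (interior (K i)) (φ i) (G i)) :
    Integrable (fun x => ydisc fun i => Hm (G i) x) ∧
      ∫ x, (ydisc fun i => Hm (G i) x) = n.factorial * mixedVolume K := by
  simp only [← mdisc_eq_ydisc, mdisc]
  have hIntg : ∀ S ∈ (Finset.univ : Finset (Finset (Fin n))), Integrable (fun x =>
      (-1 : ℝ) ^ (Fintype.card (Fin n) + S.card) * (∑ i ∈ S, Hm (G i) x).det) :=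
    fun S _ => (pot_sum_det hn hK h S).1.const_mul _
  refine ⟨integrable_finset_sum _ hIntg, ?_⟩
  rw [integral_finset_sum _ hIntg, mixedVolume, ← mul_assoc, mul_inv_cancel₀ (by positivity), one_mul]
  refine Finset.sum_congr rfl fun S _ => ?_
  rw [integral_const_mul, (pot_sum_det hn hK h S).2, Fintype.card_fin]

theorem ydisc_Hm_nonneg {K : Fin n → Set (EuclideanSpace ℝ (Fin n))}
    {φ : Fin n → EuclideanSpace ℝ (Fin n) → ℝ}
    {G : Fin n → EuclideanSpace ℝ (Fin n) → EuclideanSpace ℝ (Fin n)}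
    (h : ∀ i, IsPot (interior (K i)) (φ i) (G i)) :
    ∀ᵐ x, 0 ≤ ydisc fun i => Hm (G i) x := by
  have hae : ∀ᵐ x, ∀ i, DifferentiableAt ℝ (G i) x := ae_all_iff.2 fun i => (h i).ae_diff
  filter_upwards [hae] with x hx
  exact ydisc_nonneg _ fun i => (h i).Hm_psd (hx i)

end Potentials

section LogLaplace
open Matrix Filter Topology
open scoped RealInnerProductSpace NNReal ENNReal

variable {n : ℕ}

/-- Laplace transform on a set -/
noncomputable def lapl {W : Type*} [NormedAddCommGroup W] [NormedSpace ℝ W]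
    (K : Set (EuclideanSpace ℝ (Fin n))) (u : EuclideanSpace ℝ (Fin n) → W)
    (x : EuclideanSpace ℝ (Fin n)) : W := ∫ y in K, Real.exp ⟪x, y⟫ • u y

variable {W : Type*} [NormedAddCommGroup W] [NormedSpace ℝ W]
  {K : Set (EuclideanSpace ℝ (Fin n))}

theorem lapl_integrable (hK : IsCompact K) {u : EuclideanSpace ℝ (Fin n) → W} (hu : Continuous u)
    (x : EuclideanSpace ℝ (Fin n)) :
    Integrable (fun y => Real.exp ⟪x, y⟫ • u y) (volume.restrict K) := by
  refine ContinuousOn.integrableOn_compact hK (Continuous.continuousOn ?_)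
  fun_prop

theorem lapl_hasFDerivAt (hK : IsCompact K) {u : EuclideanSpace ℝ (Fin n) → W}
    (hu : Continuous u) (x : EuclideanSpace ℝ (Fin n)) :
    HasFDerivAt (lapl K u) (lapl K (fun y => (innerSL ℝ y).smulRight (u y)) x) x := by
  have hcont : Continuous fun y : EuclideanSpace ℝ (Fin n) =>
    (innerSL ℝ y).smulRight (u y) := by fun_prop
  obtain ⟨D, hD⟩ := hK.exists_bound_of_continuousOn (f := fun y => y) continuousOn_id
  obtain ⟨B, hB⟩ := hK.exists_bound_of_continuousOn hcont.continuousOn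
  unfold lapl
  have hmem : ∀ᵐ y ∂(volume.restrict K), y ∈ K := ae_restrict_mem hK.measurableSet
  haveI : IsFiniteMeasure (volume.restrict K) := ⟨by
    rw [Measure.restrict_apply_univ]; exact hK.measure_lt_top⟩
  refine hasFDerivAt_integral_of_dominated_of_fderiv_le (s := Metric.ball x 1)
    (bound := fun _ => Real.exp ((‖x‖ + 1) * D) * B)
    (F' := fun x y => Real.exp ⟪x, y⟫ • (innerSL ℝ y).smulRight (u y))
    (Metric.ball_mem_nhds x one_pos) ?_ (lapl_integrable hK hu x)
    (lapl_integrable hK hcont x).aestronglyMeasurable ?_ (integrable_const _) ?_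
  · exact Eventually.of_forall fun z => (lapl_integrable hK hu z).aestronglyMeasurable
  · filter_upwards [hmem] with y hy z hz
    rw [norm_smul, Real.norm_eq_abs, abs_of_pos (Real.exp_pos _)]
    have h1 : ⟪z, y⟫ ≤ (‖x‖ + 1) * D := by
      refine (real_inner_le_norm z y).trans ?_
      have : ‖z‖ ≤ ‖x‖ + 1 := by
        have := norm_le_norm_add_norm_sub' z x
        rw [Metric.mem_ball, dist_eq_norm] at hz
        linarith
      exact mul_le_mul this (hD y hy) (norm_nonneg _) (by positivity)
    exact mul_le_mul (Real.exp_le_exp.2 h1) (hB y hy) (norm_nonneg _) (Real.exp_pos _).le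
  · filter_upwards with y z _
    have h1 : HasFDerivAt (fun x : EuclideanSpace ℝ (Fin n) => ⟪x, y⟫) (innerSL ℝ y) z := by
      have := (innerSL ℝ y).hasFDerivAt (x := z)
      refine this.congr_of_eventuallyEq (Eventually.of_forall fun w => ?_)
      simp [real_inner_comm]
    have h2 := (h1.exp).smul_const (u y)
    convert h2 using 1
    ext v
    simp [mul_smul]

theorem lapl_contDiff (hK : IsCompact K) {u : EuclideanSpace ℝ (Fin n) → W}
    (hu : Continuous u) : ContDiff ℝ 1 (lapl K u) := by
  refine contDiff_one_iff_hasFDerivAt.2 ⟨_, ?_, fun x => lapl_hasFDerivAt hK hu x⟩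
  have hcont : Continuous fun y : EuclideanSpace ℝ (Fin n) =>
    (innerSL ℝ y).smulRight (u y) := by fun_prop
  exact continuous_iff_continuousAt.2 fun x => (lapl_hasFDerivAt hK hcont x).continuousAt

theorem lapl_norm_le (hK : IsCompact K) {u : EuclideanSpace ℝ (Fin n) → W}
    {C : ℝ} (hu : ∀ y ∈ K, ‖u y‖ ≤ C) (x : EuclideanSpace ℝ (Fin n)) :
    ‖lapl K u x‖ ≤ C * lapl K (fun _ => (1 : ℝ)) x := by
  unfold lapl
  have hmem : ∀ᵐ y ∂(volume.restrict K), y ∈ K := ae_restrict_mem hK.measurableSet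
  rw [← integral_const_mul]
  refine norm_integral_le_of_norm_le ((lapl_integrable hK continuous_const x).const_mul _) ?_
  filter_upwards [hmem] with y hy
  rw [norm_smul, Real.norm_eq_abs, abs_of_pos (Real.exp_pos _), smul_eq_mul, mul_one, mul_comm]
  exact mul_le_mul_of_nonneg_right (hu y hy) (Real.exp_pos _).le

theorem lapl_clm {W' : Type*} [NormedAddCommGroup W'] [NormedSpace ℝ W'] [CompleteSpace W]
    [CompleteSpace W'] (hK : IsCompact K) {u : EuclideanSpace ℝ (Fin n) → W}
    (hu : Continuous u) (T : W →L[ℝ] W') (x : EuclideanSpace ℝ (Fin n)) :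
    T (lapl K u x) = lapl K (fun y => T (u y)) x := by
  unfold lapl
  rw [← ContinuousLinearMap.integral_comp_comm _ (lapl_integrable hK hu x)]
  simp

theorem lapl_one_pos (hK : IsConvexBody K) (x : EuclideanSpace ℝ (Fin n)) :
    0 < lapl K (fun _ => (1 : ℝ)) x := by
  unfold lapl
  rw [setIntegral_pos_iff_support_of_nonneg_ae]
  · have : Function.support (fun y => Real.exp ⟪x, y⟫ • (1 : ℝ)) = Set.univ := by
      ext y; simp [Real.exp_ne_zero]
    rw [this, Set.univ_inter]
    exact (isOpen_interior.measure_pos volume hK.2.2).trans_le (measure_mono interior_subset)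
  · exact Eventually.of_forall fun y => by simp; positivity
  · exact lapl_integrable hK.2.1 continuous_const x

theorem lapl_var_pos (hK : IsConvexBody K) (x v : EuclideanSpace ℝ (Fin n)) (hv : v ≠ 0) (m : ℝ) :
    0 < lapl K (fun y => (⟪y, v⟫ - m) ^ 2) x := by
  unfold lapl
  rw [setIntegral_pos_iff_support_of_nonneg_ae]
  · have ho : IsOpen (interior K ∩ {y | ⟪y, v⟫ ≠ m}) :=
      isOpen_interior.inter (isOpen_ne_fun (by fun_prop) continuous_const)
    have hne : (interior K ∩ {y | ⟪y, v⟫ ≠ m}).Nonempty := by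
      obtain ⟨y, hy⟩ := hK.2.2
      by_cases h : ⟪y, v⟫ = m
      · have hc : Tendsto (fun t : ℝ => y + t • v) (𝓝[>] 0) (𝓝 y) := by
          have : Continuous fun t : ℝ => y + t • v := by fun_prop
          have := this.tendsto 0
          simp only [zero_smul, add_zero] at this
          exact this.mono_left nhdsWithin_le_nhds
        have h1 := hc.eventually (isOpen_interior.mem_nhds hy)
        obtain ⟨t, ht, ht0⟩ := (h1.and self_mem_nhdsWithin).exists
        have ht0 : 0 < t := ht0
        refine ⟨_, ht, ?_⟩
        simp only [Set.mem_setOf_eq, inner_add_left, h, inner_smul_left, conj_trivial]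
        have := real_inner_self_pos.2 hv
        have : 0 < t * ⟪v, v⟫ := by positivity
        linarith
      · exact ⟨y, hy, h⟩
    refine (ho.measure_pos volume hne).trans_le (measure_mono ?_)
    rintro y ⟨hy, hy2⟩
    refine ⟨?_, interior_subset hy⟩
    simp only [Function.mem_support, smul_eq_mul]
    have : ⟪y, v⟫ - m ≠ 0 := sub_ne_zero.2 hy2
    positivity
  · exact Eventually.of_forall fun y => by simp; positivity
  · exact lapl_integrable hK.2.1 (by fun_prop) x

theorem exists_smooth_pot (hK : IsConvexBody K) :
    ∃ φ G, IsPot (interior K) φ G ∧ ContDiff ℝ 1 G ∧ ∀ x, (Hm G x).PosDef := by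
  have hKc := hK.2.1
  set Z : EuclideanSpace ℝ (Fin n) → ℝ := lapl K (fun _ => (1 : ℝ)) with hZ
  set M : EuclideanSpace ℝ (Fin n) → EuclideanSpace ℝ (Fin n) := lapl K (fun y => y) with hM
  have hZpos : ∀ x, 0 < Z x := lapl_one_pos hK
  set G : EuclideanSpace ℝ (Fin n) → EuclideanSpace ℝ (Fin n) := fun x => (Z x)⁻¹ • M x with hG
  have hZd : ∀ x, HasFDerivAt Z (innerSL ℝ (M x)) x := by
    intro x
    have h1 := lapl_hasFDerivAt hKc (u := fun _ => (1 : ℝ)) continuous_const x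
    have h2 : innerSL ℝ (M x) = lapl K (fun y : EuclideanSpace ℝ (Fin n) =>
        (innerSL ℝ y).smulRight (1 : ℝ)) x := by
      rw [hM, lapl_clm hKc (u := fun y => y) continuous_id (innerSL ℝ)]
      congr 1
      funext y
      ext v
      rw [ContinuousLinearMap.smulRight_apply, smul_eq_mul, mul_one]
    rw [h2]
    exact h1
  have hMd := fun x => lapl_hasFDerivAt hKc (u := fun y => y) continuous_id x
  set M' := lapl K (fun y : EuclideanSpace ℝ (Fin n) => (innerSL ℝ y).smulRight y) with hM'
  have hcM' : Continuous fun y : EuclideanSpace ℝ (Fin n) => (innerSL ℝ y).smulRight y := by fun_prop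
  have hZi : ∀ x, HasFDerivAt (fun x => (Z x)⁻¹) (-(Z x ^ 2)⁻¹ • innerSL ℝ (M x)) x := by
    intro x
    exact (hasDerivAt_inv (hZpos x).ne').comp_hasFDerivAt x (hZd x)
  have hGd : ∀ x, HasFDerivAt G ((Z x)⁻¹ • M' x +
      (-(Z x ^ 2)⁻¹ • innerSL ℝ (M x)).smulRight (M x)) x := fun x => (hZi x).smul (hMd x)
  have hGc : ContDiff ℝ 1 G := ContDiff.smul
    ((lapl_contDiff hKc continuous_const).inv fun x => (hZpos x).ne')
    (lapl_contDiff hKc continuous_id)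
  have hquad : ∀ x v, ⟪fderiv ℝ G x v, v⟫ = (Z x)⁻¹ * lapl K (fun y => (⟪y, v⟫ - ⟪G x, v⟫) ^ 2) x := by
    intro x v
    have e1 : ⟪M' x v, v⟫ = lapl K (fun y => ⟪y, v⟫ * ⟪y, v⟫) x := by
      have := lapl_clm hKc hcM' ((innerSL ℝ v) ∘L (ContinuousLinearMap.apply ℝ _ v)) x
      rw [← hM'] at this
      simp only [ContinuousLinearMap.comp_apply, ContinuousLinearMap.apply_apply, innerSL_apply_apply] at this
      rw [real_inner_comm, this]
      congr 1
      funext y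
      simp [inner_smul_right, real_inner_comm]
    have e2 : ⟪M x, v⟫ = lapl K (fun y => ⟪y, v⟫) x := by
      have := lapl_clm hKc (u := fun y => y) continuous_id (innerSL ℝ v) x
      rw [real_inner_comm]
      simpa [real_inner_comm] using this
    have e3 : lapl K (fun y => (⟪y, v⟫ - ⟪G x, v⟫) ^ 2) x =
        lapl K (fun y => ⟪y, v⟫ * ⟪y, v⟫) x - 2 * ⟪G x, v⟫ * lapl K (fun y => ⟪y, v⟫) x +
          ⟪G x, v⟫ ^ 2 * Z x := by
      rw [hZ]
      unfold lapl
      rw [← integral_const_mul, ← integral_const_mul, ← integral_sub, ← integral_add]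
      · congr 1
        funext y
        simp only [smul_eq_mul]
        ring
      · exact (lapl_integrable hKc (by fun_prop) x).sub
          ((lapl_integrable hKc (by fun_prop) x).const_mul _)
      · exact (lapl_integrable hKc (by fun_prop) x).const_mul _
      · exact lapl_integrable hKc (by fun_prop) x
      · exact (lapl_integrable hKc (by fun_prop) x).const_mul _
    have e4 : ⟪G x, v⟫ = (Z x)⁻¹ * ⟪M x, v⟫ := by
      simp [hG, inner_smul_left]
    rw [(hGd x).fderiv, e3, ← e1, ← e2, e4]
    have := (hZpos x).ne'
    simp only [_root_.add_apply, _root_.smul_apply, ContinuousLinearMap.smulRight_apply,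
      innerSL_apply_apply, inner_add_left, inner_smul_left, conj_trivial, smul_eq_mul]
    field_simp
    ring
  have hcl : closure (interior K) = K := by
    rw [hK.1.closure_interior_eq_closure_of_nonempty_interior hK.2.2, hKc.isClosed.closure_eq]
  have hpot : IsPot (interior K) (fun x => Real.log (Z x)) G := by
    refine ⟨isOpen_interior, hK.1.interior, ?_, ?_, ?_, ?_, ?_⟩
    · intro x
      have := (hZd x).log (hZpos x).ne'
      rw [hG, map_smul]
      exact this
    · intro x
      rw [hcl]
      by_contra hx
      obtain ⟨l, u, h1, h2⟩ := geometric_hahn_banach_closed_point hK.1 hKc.isClosed hx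
      have e : l (G x) = (Z x)⁻¹ * lapl K (fun y => l y) x := by
        simp only [hG, map_smul, smul_eq_mul]
        rw [hM, lapl_clm hKc (u := fun y => y) continuous_id l]
      have hle : lapl K (fun y => l y) x ≤ u * Z x := by
        rw [hZ]; unfold lapl
        rw [← integral_const_mul]
        refine integral_mono_ae (lapl_integrable hKc l.continuous x)
          ((lapl_integrable hKc continuous_const x).const_mul _) ?_
        filter_upwards [ae_restrict_mem hKc.measurableSet] with y hy
        simp only [smul_eq_mul, mul_one]
        rw [mul_comm]
        exact mul_le_mul_of_nonneg_right (h1 y hy).le (Real.exp_pos _).le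
      rw [e, inv_mul_eq_div, lt_div_iff₀ (hZpos x)] at h2
      linarith
    · intro x y
      set v := x - y with hv
      have hd : ∀ t : ℝ, HasDerivAt (fun t : ℝ => ⟪G (y + t • v), v⟫)
          ⟪fderiv ℝ G (y + t • v) v, v⟫ t := by
        intro t
        have h2 : HasDerivAt (fun t : ℝ => y + t • v) v t := by
          simpa using ((hasDerivAt_id t).smul_const v).const_add y
        have h3 := (hGc.differentiable one_ne_zero (y + t • v)).hasFDerivAt.comp_hasDerivAt t h2
        simpa using h3.inner ℝ (hasDerivAt_const t v)
      have hmono : Monotone (fun t : ℝ => ⟪G (y + t • v), v⟫) := by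
        refine monotone_of_deriv_nonneg (fun t => (hd t).differentiableAt) fun t => ?_
        rw [(hd t).deriv, hquad]
        refine mul_nonneg (inv_nonneg.2 (hZpos _).le) ?_
        unfold lapl
        exact integral_nonneg fun y => by simp; positivity
      have := hmono (zero_le_one' ℝ)
      simp only [zero_smul, one_smul, add_zero] at this
      have e : y + v = x := by rw [hv]; abel
      rw [e] at this
      rw [inner_sub_left]; linarith
    · obtain ⟨D, hD⟩ := hKc.exists_bound_of_continuousOn (f := fun y => y) continuousOn_id
      have hD0 : 0 ≤ D := by
        obtain ⟨y, hy⟩ := hK.2.2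
        exact (norm_nonneg _).trans (hD y (interior_subset hy))
      refine ⟨Real.toNNReal (D * D + D * D), lipschitzWith_of_nnnorm_fderiv_le
        (hGc.differentiable one_ne_zero) fun x => ?_⟩
      rw [← NNReal.coe_le_coe, coe_nnnorm, (hGd x).fderiv,
        Real.coe_toNNReal _ (by positivity)]
      have hz := hZpos x
      have b1 : ‖M' x‖ ≤ D * D * Z x := by
        refine lapl_norm_le hKc (fun y hy => ?_) x
        rw [ContinuousLinearMap.norm_smulRight_apply, innerSL_apply_norm]
        exact mul_le_mul (hD y hy) (hD y hy) (norm_nonneg _) hD0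
      have b2 : ‖M x‖ ≤ D * Z x := lapl_norm_le hKc hD x
      refine (norm_add_le _ _).trans (add_le_add ?_ ?_)
      · rw [norm_smul, norm_inv, Real.norm_eq_abs, abs_of_pos hz, inv_mul_le_iff₀ hz]
        linarith
      · rw [ContinuousLinearMap.norm_smulRight_apply, norm_smul, innerSL_apply_norm, norm_neg,
          norm_inv, Real.norm_eq_abs, abs_of_pos (by positivity), mul_assoc,
          inv_mul_le_iff₀ (by positivity)]
        calc ‖M x‖ * ‖M x‖ ≤ (D * Z x) * (D * Z x) := by gcongr
          _ = _ := by ring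
    · intro p hp
      obtain ⟨r, hr, hrK⟩ := Metric.isOpen_iff.1 isOpen_interior p hp
      set r2 := r / 2 with hr2
      have hr2p : 0 < r2 := by positivity
      set V : ℝ := (volume (Metric.closedBall (0 : EuclideanSpace ℝ (Fin n)) (r2 / 2))).toReal with hV
      have hVpos : 0 < V := by
        refine ENNReal.toReal_pos (Metric.measure_closedBall_pos _ _ (by positivity)).ne'
          (isCompact_closedBall _ _).measure_lt_top.ne
      have hlow : ∀ x, r2 / 2 * ‖x‖ + Real.log V ≤ Real.log (Z x) - ⟪p, x⟫ := by
        intro x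
        set S := Metric.closedBall (p + (r2 * ‖x‖⁻¹) • x) (r2 / 2) with hS
        have hn1 : ‖(r2 * ‖x‖⁻¹) • x‖ ≤ r2 := by
          rw [norm_smul, norm_mul, norm_inv, norm_norm, Real.norm_eq_abs, abs_of_pos hr2p, mul_assoc]
          exact mul_le_of_le_one_right hr2p.le inv_mul_le_one
        have hSK : S ⊆ K := by
          intro y hy
          refine interior_subset (hrK ?_)
          rw [Metric.mem_ball, dist_eq_norm]
          rw [hS, Metric.mem_closedBall, dist_eq_norm] at hy
          have e : y - p = (y - (p + (r2 * ‖x‖⁻¹) • x)) + (r2 * ‖x‖⁻¹) • x := by abel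
          rw [e]
          refine (norm_add_le _ _).trans_lt ?_
          linarith
        have hSb : ∀ y ∈ S, ⟪p, x⟫ + r2 / 2 * ‖x‖ ≤ ⟪x, y⟫ := by
          intro y hy
          rw [hS, Metric.mem_closedBall, dist_eq_norm] at hy
          set w := y - (p + (r2 * ‖x‖⁻¹) • x) with hw
          have e : y = w + p + (r2 * ‖x‖⁻¹) • x := by rw [hw]; abel
          have h1 : ⟪x, w⟫ ≥ - (‖x‖ * (r2 / 2)) := by
            have := abs_real_inner_le_norm x w
            have := (abs_le.1 this).1
            have : ‖x‖ * ‖w‖ ≤ ‖x‖ * (r2 / 2) := by gcongr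
            linarith
          have h2 : ⟪x, (r2 * ‖x‖⁻¹) • x⟫ = r2 * ‖x‖ := by
            rw [inner_smul_right, real_inner_self_eq_norm_sq]
            by_cases hx : ‖x‖ = 0
            · simp [hx]
            · field_simp
          rw [e, inner_add_right, inner_add_right, h2, real_inner_comm x p]
          linarith
        have hZlow : Real.exp (⟪p, x⟫ + r2 / 2 * ‖x‖) * V ≤ Z x := by
          have hVS : V = volume.real S := by
            rw [hV, hS, Measure.real, Measure.addHaar_closedBall_center volume (p + _)]
          calc Real.exp (⟪p, x⟫ + r2 / 2 * ‖x‖) * V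
              = ∫ y in S, Real.exp (⟪p, x⟫ + r2 / 2 * ‖x‖) := by
                rw [setIntegral_const, hVS, smul_eq_mul, mul_comm]
            _ ≤ ∫ y in S, Real.exp ⟪x, y⟫ • (1 : ℝ) := by
                refine setIntegral_mono_on
                  (integrableOn_const (isCompact_closedBall _ _).measure_lt_top.ne)
                  ((lapl_integrable hKc continuous_const x).mono_measure
                    (Measure.restrict_mono hSK le_rfl)) measurableSet_closedBall fun y hy => ?_
                simp only [smul_eq_mul, mul_one]
                exact Real.exp_le_exp.2 (hSb y hy)
            _ ≤ Z x := by
                rw [hZ]; unfold lapl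
                refine setIntegral_mono_set (lapl_integrable hKc continuous_const x) ?_
                  (LE.le.eventuallyLE hSK)
                exact Eventually.of_forall fun y => by simp; positivity
        have := Real.log_le_log (by positivity) hZlow
        rw [Real.log_mul (Real.exp_ne_zero _) hVpos.ne', Real.log_exp] at this
        linarith
      refine tendsto_atTop_mono hlow ?_
      refine tendsto_atTop_add_const_right _ _ ?_
      exact (tendsto_norm_cocompact_atTop).const_mul_atTop (by positivity)
  refine ⟨_, G, hpot, hGc, fun x => ?_⟩
  have hpsd := hpot.Hm_psd (hGc.differentiable one_ne_zero x)
  refine PosDef.of_dotProduct_mulVec_pos hpsd.1 fun v hv => ?_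
  rw [Hm_quad, hquad]
  have := hZpos x
  have := lapl_var_pos hK x (WithLp.toLp 2 v) (by simpa using hv) ⟪G x, WithLp.toLp 2 v⟫
  positivity

theorem Hm_continuous {G : EuclideanSpace ℝ (Fin n) → EuclideanSpace ℝ (Fin n)}
    (hG : ContDiff ℝ 1 G) : Continuous (Hm G) := by
  refine continuous_matrix fun i j => ?_
  simp only [Hm_apply]
  have := hG.continuous_fderiv one_ne_zero
  fun_prop

end LogLaplace

section Transport
open Matrix Filter Topology
open scoped RealInnerProductSpace NNReal ENNReal BoundedContinuousFunction

variable {n : ℕ} {S : Set (EuclideanSpace ℝ (Fin n))}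

/-- conjugate of a function on a compact set -/
noncomputable def cj (k : S → ℝ) (x : EuclideanSpace ℝ (Fin n)) : ℝ :=
  ⨆ y : S, (⟪(y : EuclideanSpace ℝ (Fin n)), x⟫ - k y)

theorem cj_bdd (hS : IsCompact S) {k : S → ℝ} (hk : Continuous k) (x : EuclideanSpace ℝ (Fin n)) :
    BddAbove (Set.range fun y : S => (⟪(y : EuclideanSpace ℝ (Fin n)), x⟫ - k y)) := by
  haveI := isCompact_iff_compactSpace.1 hS
  exact (isCompact_range (by fun_prop)).bddAbove

theorem le_cj (hS : IsCompact S) {k : S → ℝ} (hk : Continuous k) (x : EuclideanSpace ℝ (Fin n))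
    (y : S) : ⟪(y : EuclideanSpace ℝ (Fin n)), x⟫ - k y ≤ cj k x :=
  le_ciSup (cj_bdd hS hk x) y

theorem cj_exists (hS : IsCompact S) (hne : S.Nonempty) {k : S → ℝ} (hk : Continuous k)
    (x : EuclideanSpace ℝ (Fin n)) :
    ∃ y : S, cj k x = ⟪(y : EuclideanSpace ℝ (Fin n)), x⟫ - k y := by
  haveI := isCompact_iff_compactSpace.1 hS
  haveI := hne.to_subtype
  obtain ⟨y, -, hy⟩ := isCompact_univ.exists_isMaxOn (f := fun y : S =>
    (⟪(y : EuclideanSpace ℝ (Fin n)), x⟫ - k y)) Set.univ_nonempty (by fun_prop)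
  exact ⟨y, le_antisymm (ciSup_le fun z => hy (Set.mem_univ z)) (le_cj hS hk x y)⟩

theorem cj_le_add (hS : IsCompact S) (hne : S.Nonempty) {k k' : S → ℝ} (hk : Continuous k)
    (hk' : Continuous k') {e : ℝ} (h : ∀ y, k y ≤ k' y + e) (x : EuclideanSpace ℝ (Fin n)) :
    cj k' x ≤ cj k x + e := by
  obtain ⟨y, hy⟩ := cj_exists hS hne hk' x
  have := le_cj hS hk x y
  have := h y
  linarith

theorem cj_subgrad (hS : IsCompact S) {k : S → ℝ} (hk : Continuous k)
    {x : EuclideanSpace ℝ (Fin n)} {y : S} (hy : cj k x = ⟪(y : EuclideanSpace ℝ (Fin n)), x⟫ - k y)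
    (z : EuclideanSpace ℝ (Fin n)) :
    cj k x + ⟪(y : EuclideanSpace ℝ (Fin n)), z - x⟫ ≤ cj k z := by
  have := le_cj hS hk z y
  rw [hy, inner_sub_right]; linarith

theorem cj_lip (hS : IsCompact S) (hne : S.Nonempty) {k : S → ℝ} (hk : Continuous k) {D : ℝ≥0}
    (hD : ∀ y ∈ S, ‖y‖ ≤ D) : LipschitzWith D (cj k) := by
  refine LipschitzWith.of_le_add_mul _ fun x z => ?_
  obtain ⟨y, hy⟩ := cj_exists hS hne hk x
  have h1 := cj_subgrad hS hk hy z
  have h2 := real_inner_le_norm (y : EuclideanSpace ℝ (Fin n)) (x - z)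
  have h3 : ‖(y : EuclideanSpace ℝ (Fin n))‖ * ‖x - z‖ ≤ D * ‖x - z‖ :=
    mul_le_mul_of_nonneg_right (hD y y.2) (norm_nonneg _)
  rw [dist_eq_norm]
  have e : z - x = -(x - z) := by abel
  rw [e, inner_neg_right] at h1
  linarith

theorem cj_convex (hS : IsCompact S) (hne : S.Nonempty) {k : S → ℝ} (hk : Continuous k) :
    ConvexOn ℝ Set.univ (cj k) := by
  refine ⟨convex_univ, fun x _ z _ a b ha hb hab => ?_⟩
  obtain ⟨y, hy⟩ := cj_exists hS hne hk (a • x + b • z)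
  have h1 := le_cj hS hk x y
  have h2 := le_cj hS hk z y
  rw [hy, inner_add_right, inner_smul_right, inner_smul_right]
  simp only [smul_eq_mul]
  have : k y = a * k y + b * k y := by rw [← add_mul, hab, one_mul]
  nlinarith [mul_le_mul_of_nonneg_left h1 ha, mul_le_mul_of_nonneg_left h2 hb]

theorem grad_eq_of_subgrad {g : EuclideanSpace ℝ (Fin n) → ℝ} {a v : EuclideanSpace ℝ (Fin n)}
    (hd : DifferentiableAt ℝ g a) (h : ∀ᶠ b in 𝓝 a, g a + ⟪v, b - a⟫ ≤ g b) :
    (InnerProductSpace.toDual ℝ (EuclideanSpace ℝ (Fin n))).symm (fderiv ℝ g a) = v := by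
  have h1 : HasFDerivAt (fun b => g b - ⟪v, b⟫) (fderiv ℝ g a - innerSL ℝ v) a :=
    hd.hasFDerivAt.sub (innerSL ℝ v).hasFDerivAt
  have hmin : IsLocalMin (fun b => g b - ⟪v, b⟫) a := by
    filter_upwards [h] with b hb
    rw [inner_sub_right] at hb
    linarith
  have h0 := sub_eq_zero.1 (hmin.hasFDerivAt_eq_zero h1)
  rw [h0, LinearIsometryEquiv.symm_apply_eq]
  ext w
  simp

/-- gradient as a map into a ball -/
noncomputable def gr (g : EuclideanSpace ℝ (Fin n) → ℝ) (a : EuclideanSpace ℝ (Fin n)) :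
    EuclideanSpace ℝ (Fin n) :=
  (InnerProductSpace.toDual ℝ (EuclideanSpace ℝ (Fin n))).symm (fderiv ℝ g a)

theorem gr_measurable (g : EuclideanSpace ℝ (Fin n) → ℝ) : Measurable (gr g) :=
  (LinearIsometryEquiv.continuous _).measurable.comp (measurable_fderiv ℝ g)

theorem gr_mem {R : ℝ≥0} {g : EuclideanSpace ℝ (Fin n) → ℝ} (hg : LipschitzWith R g)
    (a : EuclideanSpace ℝ (Fin n)) : gr g a ∈ Metric.closedBall (0 : EuclideanSpace ℝ (Fin n)) R := by
  rw [mem_closedBall_zero_iff, gr, LinearIsometryEquiv.norm_map]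
  exact norm_fderiv_le_of_lipschitz ℝ hg

theorem ot_exists_min {R : ℝ≥0} {X A : Set (EuclideanSpace ℝ (Fin n))} (hXc : IsCompact X)
    (h0X : (0 : EuclideanSpace ℝ (Fin n)) ∈ X) (hXR : ∀ y ∈ X, ‖y‖ ≤ R) (hA : IsCompact A)
    (hne : A.Nonempty) (ν : Measure X)
    [IsFiniteMeasure ν] (hν : ν Set.univ = volume A) :
    ∃ φ : X →ᵇ ℝ, ∀ φ' : X →ᵇ ℝ,
      (∫ x, φ x ∂ν) + ∫ a in A, cj (fun x => φ x) a ≤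
        (∫ x, φ' x ∂ν) + ∫ a in A, cj (fun x => φ' x) a := by
  haveI : CompactSpace X := isCompact_iff_compactSpace.1 hXc
  have hXne : X.Nonempty := ⟨0, h0X⟩
  haveI : Nonempty X := ⟨⟨0, h0X⟩⟩
  haveI : IsFiniteMeasure (volume.restrict A) := ⟨by
    rw [Measure.restrict_apply_univ]; exact hA.measure_lt_top⟩
  have hclip : ∀ φ : X →ᵇ ℝ, LipschitzWith R (cj (fun x => φ x)) := fun φ =>
    cj_lip hXc hXne φ.continuous hXR
  have hIntg : ∀ φ : X →ᵇ ℝ, Integrable (cj (fun x => φ x)) (volume.restrict A) := fun φ =>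
    (hclip φ).continuous.continuousOn.integrableOn_compact hA
  have hIntg2 : ∀ φ : X →ᵇ ℝ, Integrable (fun x => φ x) ν := fun φ => φ.integrable ν
  set F : (X →ᵇ ℝ) → ℝ := fun φ => (∫ x, φ x ∂ν) + ∫ a in A, cj (fun x => φ x) a with hF
  -- monotonicity of F
  have hmono : ∀ φ φ' : X →ᵇ ℝ, (∀ x, φ x ≤ φ' x) → (∀ a ∈ A, cj (fun x => φ x) a ≤
      cj (fun x => φ' x) a) → F φ ≤ F φ' := by
    intro φ φ' h1 h2
    refine add_le_add (integral_mono (hIntg2 φ) (hIntg2 φ') h1) ?_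
    exact setIntegral_mono_on (hIntg φ) (hIntg φ') hA.measurableSet h2
  have hAreal : ν.real Set.univ = (volume A).toReal := by rw [Measure.real, hν]
  have hconst : ∀ (φ : X →ᵇ ℝ) (t : ℝ), F (φ - BoundedContinuousFunction.const X t) = F φ := by
    intro φ t
    have e : ∀ a, cj (fun x => (φ - BoundedContinuousFunction.const X t) x) a =
        cj (fun x => φ x) a + t := by
      intro a
      apply le_antisymm
      · exact cj_le_add hXc hXne φ.continuous (BoundedContinuousFunction.continuous _)
          (fun y => by simp) a
      · have := cj_le_add hXc hXne (k := fun x => (φ - BoundedContinuousFunction.const X t) x)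
          (k' := fun x => φ x) (e := -t)
          (BoundedContinuousFunction.continuous _) φ.continuous (fun y => by simp) a
        linarith
    simp only [hF, e]
    rw [integral_add (hIntg φ) (integrable_const _), integral_const]
    simp only [BoundedContinuousFunction.coe_sub, Pi.sub_apply, BoundedContinuousFunction.const_apply]
    rw [integral_sub (hIntg2 φ) (integrable_const _), integral_const, hAreal]
    simp [Measure.real]
  -- continuity of F
  have hFc : Continuous F := by
    have hC : ∀ φ φ' : X →ᵇ ℝ, F φ ≤ F φ' + ((volume A).toReal + (volume A).toReal) * dist φ φ' := by
      intro φ φ'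
      have hd : ∀ x, φ x ≤ φ' x + dist φ φ' := fun x => by
        have := BoundedContinuousFunction.dist_coe_le_dist (f := φ) (g := φ') x
        rw [Real.dist_eq] at this
        have := (abs_le.1 this).2
        linarith
      have hd' : ∀ x, φ' x ≤ φ x + dist φ φ' := fun x => by
        have := BoundedContinuousFunction.dist_coe_le_dist (f := φ) (g := φ') x
        rw [Real.dist_eq] at this
        have := (abs_le.1 this).1
        linarith
      have i1 : ∫ x, φ x ∂ν ≤ ∫ x, (φ' x + dist φ φ') ∂ν :=
        integral_mono (hIntg2 φ) ((hIntg2 φ').add (integrable_const _)) hd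
      have i2 : ∫ a in A, cj (fun x => φ x) a ≤ ∫ a in A, (cj (fun x => φ' x) a + dist φ φ') := by
        refine integral_mono (hIntg φ) ((hIntg φ').add (integrable_const _)) fun a => ?_
        exact cj_le_add hXc hXne φ'.continuous φ.continuous hd' a
      rw [integral_add (hIntg2 φ') (integrable_const _), integral_const, hAreal, smul_eq_mul] at i1
      rw [integral_add (hIntg φ') (integrable_const _), integral_const, smul_eq_mul,
        Measure.real, Measure.restrict_apply_univ] at i2
      simp only [hF]
      linarith
    have := LipschitzWith.of_le_add_mul
      (Real.toNNReal ((volume A).toReal + (volume A).toReal)) (f := F) (fun φ φ' => by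
        rw [Real.coe_toNNReal _ (by positivity)]; exact hC φ φ')
    exact this.continuous
  -- compactness
  obtain ⟨D', hD'⟩ := hA.exists_bound_of_continuousOn (f := fun y => y) continuousOn_id
  set D : ℝ≥0 := Real.toNNReal D' with hD
  have hDA : ∀ y ∈ A, ‖y‖ ≤ D := fun y hy => (hD' y hy).trans (Real.le_coe_toNNReal _)
  set Q : Set (X →ᵇ ℝ) := {φ | LipschitzWith D φ ∧ φ ⟨0, h0X⟩ = 0} with hQ
  have hQc : IsCompact Q := by
    refine BoundedContinuousFunction.arzela_ascoli₂ (Metric.closedBall (0:ℝ) (D * R))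
      (isCompact_closedBall _ _) Q ?_ ?_ ?_
    · have e : Q = (⋂ x : X, ⋂ y : X, {φ : X →ᵇ ℝ | dist (φ x) (φ y) ≤ D * dist x y}) ∩
        {φ | φ ⟨0, h0X⟩ = 0} := by
        ext φ
        simp [hQ, lipschitzWith_iff_dist_le_mul]
      rw [e]
      have hev : ∀ x : X, Continuous fun φ : X →ᵇ ℝ => φ x := fun x =>
        (BoundedContinuousFunction.lipschitz_eval_const x).continuous
      refine IsClosed.inter (isClosed_iInter fun x => isClosed_iInter fun y => ?_) ?_
      · exact isClosed_le ((hev x).dist (hev y)) continuous_const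
      · exact isClosed_eq (hev _) continuous_const
    · rintro φ x ⟨h1, h2⟩
      have := h1.dist_le_mul x ⟨0, h0X⟩
      rw [h2] at this
      rw [Metric.mem_closedBall]
      refine this.trans (mul_le_mul_of_nonneg_left ?_ D.2)
      rw [Subtype.dist_eq, dist_zero_right]
      exact hXR x x.2
    · refine LipschitzWith.uniformEquicontinuous _ D (fun φ => φ.2.1) |>.equicontinuous
  have hQne : Q.Nonempty := ⟨0, by
    simp only [hQ, Set.mem_ofPred_eq]
    exact ⟨(LipschitzWith.const (0:ℝ)).weaken bot_le, rfl⟩⟩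
  obtain ⟨φ0, hφ0, hmin⟩ := hQc.exists_isMinOn hQne hFc.continuousOn
  refine ⟨φ0, fun φ => ?_⟩
  change F φ0 ≤ F φ
  have hkc : Continuous fun a : A => cj (fun x => φ x) (a : EuclideanSpace ℝ (Fin n)) :=
    (hclip φ).continuous.comp continuous_subtype_val
  set w : EuclideanSpace ℝ (Fin n) → ℝ :=
    cj (fun a : A => cj (fun x => φ x) (a : EuclideanSpace ℝ (Fin n))) with hw
  have hwl : LipschitzWith D w := cj_lip hA hne hkc hDA
  set φ1 : X →ᵇ ℝ := BoundedContinuousFunction.mkOfCompact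
    ⟨fun x : X => w x, hwl.continuous.comp continuous_subtype_val⟩ with hφ1
  have hφ1a : ∀ x : X, φ1 x = w x := fun x => rfl
  have hle : F φ1 ≤ F φ := by
    refine hmono _ _ (fun x => ?_) (fun a ha => ?_)
    · rw [hφ1a]
      obtain ⟨a, haw⟩ := cj_exists hA hne hkc x
      have := le_cj hXc φ.continuous (a : EuclideanSpace ℝ (Fin n)) x
      rw [hw, haw, real_inner_comm]
      linarith
    · obtain ⟨x, hx⟩ := cj_exists hXc hXne φ1.continuous a
      have := le_cj hA hkc (x : EuclideanSpace ℝ (Fin n)) ⟨a, ha⟩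
      rw [hx, hφ1a, real_inner_comm]
      simp only [← hw] at this
      linarith
  have hmem : φ1 - BoundedContinuousFunction.const X (φ1 ⟨0, h0X⟩) ∈ Q := by
    refine ⟨?_, by simp⟩
    refine LipschitzWith.of_dist_le_mul fun x y => ?_
    simp only [BoundedContinuousFunction.coe_sub, Pi.sub_apply,
      BoundedContinuousFunction.const_apply, dist_sub_right, hφ1a]
    exact hwl.dist_le_mul x y
  have := hmin hmem
  simp only [Set.mem_ofPred_eq, hconst] at this
  exact this.trans hle

end Transport

section FirstVar
open Matrix Filter Topology
open scoped RealInnerProductSpace NNReal ENNReal BoundedContinuousFunction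

variable {n : ℕ}

theorem cj_argmax_eq {X : Set (EuclideanSpace ℝ (Fin n))} (hXc : IsCompact X) {k : X → ℝ}
    (hk : Continuous k) {a : EuclideanSpace ℝ (Fin n)} (hd : DifferentiableAt ℝ (cj k) a) {y : X}
    (hy : cj k a = ⟪(y : EuclideanSpace ℝ (Fin n)), a⟫ - k y) :
    gr (cj k) a = y :=
  grad_eq_of_subgrad hd (Eventually.of_forall fun b => cj_subgrad hXc hk hy b)

theorem cj_var_tendsto {X : Set (EuclideanSpace ℝ (Fin n))} (hXc : IsCompact X)
    (hXne : X.Nonempty) (φ : X →ᵇ ℝ) (h : EuclideanSpace ℝ (Fin n) →ᵇ ℝ) {t : ℕ → ℝ}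
    (ht : ∀ j, 0 < t j) (ht0 : Tendsto t atTop (𝓝 0))
    {a : EuclideanSpace ℝ (Fin n)} (hd : DifferentiableAt ℝ (cj (fun x => φ x)) a) :
    Tendsto (fun j => (cj (fun x : X => φ x + t j * h x) a - cj (fun x => φ x) a) / t j) atTop
      (𝓝 (- h (gr (cj (fun x => φ x)) a))) := by
  haveI : CompactSpace X := isCompact_iff_compactSpace.1 hXc
  have hc : ∀ j, Continuous fun x : X => φ x + t j * h x := fun j => by fun_prop
  choose x hx using fun j => cj_exists hXc hXne (hc j) a
  obtain ⟨y, hy⟩ := cj_exists hXc hXne φ.continuous a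
  have hyg := cj_argmax_eq hXc φ.continuous hd hy
  have hb : ∀ z, |h z| ≤ ‖h‖ := fun z => h.norm_coe_le_norm z
  have hp : Tendsto (fun j => ⟪(x j : EuclideanSpace ℝ (Fin n)), a⟫ - φ (x j)) atTop
      (𝓝 (cj (fun x => φ x) a)) := by
    have hlow : Tendsto (fun j => cj (fun x => φ x) a - t j * (2 * ‖h‖)) atTop
        (𝓝 (cj (fun x => φ x) a)) := by
      have := (tendsto_const_nhds (x := cj (fun x => φ x) a)).sub (ht0.mul_const (2 * ‖h‖))
      simpa using this
    refine tendsto_of_tendsto_of_tendsto_of_le_of_le hlow tendsto_const_nhds (fun j => ?_)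
      (fun j => le_cj hXc φ.continuous a (x j))
    have h1 := le_cj hXc (hc j) a y
    have h2 := hx j
    have h3 := mul_le_mul_of_nonneg_left (abs_le.1 (hb y)).2 (ht j).le
    have h4 := mul_le_mul_of_nonneg_left (abs_le.1 (hb (x j))).1 (ht j).le
    simp only at h1 h2 ⊢
    linarith
  have hxl : Tendsto x atTop (𝓝 y) := by
    refine tendsto_nhds_of_unique_mapClusterPt fun z hz => ?_
    have hcont : Continuous fun w : X => ⟪(w : EuclideanSpace ℝ (Fin n)), a⟫ - φ w := by fun_prop
    have h1 := hz.continuousAt_comp hcont.continuousAt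
    have h2 : ⟪(z : EuclideanSpace ℝ (Fin n)), a⟫ - φ z = cj (fun x => φ x) a :=
      @eq_of_nhds_neBot _ _ _ _ _ (NeBot.mono h1 (inf_le_inf_left _ hp))
    have := cj_argmax_eq hXc φ.continuous hd h2.symm
    exact Subtype.ext (this.symm.trans hyg)
  have hhx : Tendsto (fun j => - h (x j)) atTop (𝓝 (- h y)) :=
    (((h.continuous.comp continuous_subtype_val).tendsto y).comp hxl).neg
  rw [hyg]
  refine tendsto_of_tendsto_of_tendsto_of_le_of_le tendsto_const_nhds hhx (fun j => ?_) (fun j => ?_)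
  · rw [le_div_iff₀ (ht j)]
    have h1 := le_cj hXc (hc j) a y
    linarith
  · change _ / _ ≤ _
    rw [div_le_iff₀ (ht j)]
    have h1 := le_cj hXc φ.continuous a (x j)
    have h2 := hx j
    linarith

theorem ot_map {R : ℝ≥0} {X A : Set (EuclideanSpace ℝ (Fin n))} (hXc : IsCompact X)
    (h0X : (0 : EuclideanSpace ℝ (Fin n)) ∈ X) (hXR : ∀ y ∈ X, ‖y‖ ≤ R) (hA : IsCompact A)
    (hne : A.Nonempty) (ν : Measure X)
    [IsFiniteMeasure ν] (hν : ν Set.univ = volume A) :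
    ∃ g : EuclideanSpace ℝ (Fin n) → ℝ, LipschitzWith R g ∧ ConvexOn ℝ Set.univ g ∧
      (volume.restrict A).map (gr g) = ν.map Subtype.val := by
  obtain ⟨φ, hφ⟩ := ot_exists_min hXc h0X hXR hA hne ν hν
  have hXne : X.Nonempty := ⟨0, h0X⟩
  haveI : CompactSpace X := isCompact_iff_compactSpace.1 hXc
  haveI : IsFiniteMeasure (volume.restrict A) := ⟨by
    rw [Measure.restrict_apply_univ]; exact hA.measure_lt_top⟩
  have hgl : LipschitzWith R (cj (fun x => φ x)) := cj_lip hXc hXne φ.continuous hXR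
  refine ⟨cj (fun x => φ x), hgl, cj_convex hXc hXne φ.continuous, ?_⟩
  set g := cj (fun x => φ x) with hg
  have key : ∀ h : EuclideanSpace ℝ (Fin n) →ᵇ ℝ,
      ∫ a in A, h (gr g a) ≤ ∫ x : X, h (x : EuclideanSpace ℝ (Fin n)) ∂ν := by
    intro h
    set t : ℕ → ℝ := fun j => 1 / ((j : ℝ) + 1) with ht
    have htp : ∀ j, 0 < t j := fun j => by simp only [ht]; positivity
    have ht0 : Tendsto t atTop (𝓝 0) := tendsto_one_div_add_atTop_nhds_zero_nat
    have hc : ∀ j, Continuous fun x : X => φ x + t j * h x := fun j => by fun_prop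
    have hcl : ∀ j, LipschitzWith R (cj fun x : X => φ x + t j * h x) := fun j =>
      cj_lip hXc hXne (hc j) hXR
    have hb : ∀ z, |h z| ≤ ‖h‖ := fun z => h.norm_coe_le_norm z
    have hlim : Tendsto (fun j => ∫ a in A, (cj (fun x : X => φ x + t j * h x) a - g a) / t j) atTop
        (𝓝 (∫ a in A, - h (gr g a))) := by
      refine tendsto_integral_of_dominated_convergence (fun _ => ‖h‖) (fun j => ?_)
        (integrable_const _) (fun j => ?_) ?_
      · exact (((hcl j).continuous.sub hgl.continuous).div_const _).aestronglyMeasurable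
      · refine Eventually.of_forall fun a => ?_
        rw [Real.norm_eq_abs, abs_div, abs_of_pos (htp j), div_le_iff₀ (htp j), abs_le]
        have h1 := cj_le_add hXc hXne (hc j) φ.continuous (e := ‖h‖ * t j) (fun y => by
          have := mul_le_mul_of_nonneg_left (abs_le.1 (hb y)).2 (htp j).le
          linarith) a
        have h2 := cj_le_add hXc hXne φ.continuous (hc j) (e := ‖h‖ * t j) (fun y => by
          have := mul_le_mul_of_nonneg_left (abs_le.1 (hb y)).1 (htp j).le
          linarith) a
        constructor <;> linarith
      · have hae : ∀ᵐ a ∂(volume.restrict A), DifferentiableAt ℝ g a :=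
          ae_restrict_of_ae hgl.ae_differentiableAt
        filter_upwards [hae] with a ha
        exact cj_var_tendsto hXc hXne φ h htp ht0 ha
    have hge : ∀ j, - ∫ x : X, h (x : EuclideanSpace ℝ (Fin n)) ∂ν ≤
        ∫ a in A, (cj (fun x : X => φ x + t j * h x) a - g a) / t j := by
      intro j
      set hX : X →ᵇ ℝ := h.compContinuous ⟨Subtype.val, continuous_subtype_val⟩ with hhX
      have e := hφ (φ + t j • hX)
      have e1 : (fun x => (φ + t j • hX) x) = fun x : X => φ x + t j * h x := by
        funext x; simp [hhX]
      rw [e1] at e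
      have i1 : ∫ x : X, (φ x + t j * h x) ∂ν = ∫ x, φ x ∂ν + t j * ∫ x : X, h x ∂ν := by
        have hi : Integrable (fun x : X => h (x : EuclideanSpace ℝ (Fin n))) ν := hX.integrable ν
        rw [integral_add (φ.integrable ν) (hi.const_mul _), integral_const_mul]
      rw [i1] at e
      rw [integral_div, le_div_iff₀ (htp j), integral_sub
        ((hcl j).continuous.continuousOn.integrableOn_compact hA)
        (hgl.continuous.continuousOn.integrableOn_compact hA)]
      linarith
    have := ge_of_tendsto' hlim hge
    rw [integral_neg] at this
    linarith
  have keq : ∀ h : EuclideanSpace ℝ (Fin n) →ᵇ ℝ,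
      ∫ a in A, h (gr g a) = ∫ x : X, h (x : EuclideanSpace ℝ (Fin n)) ∂ν := by
    intro h
    refine le_antisymm (key h) ?_
    have := key (-h)
    simp only [BoundedContinuousFunction.coe_neg, Pi.neg_apply, integral_neg] at this
    linarith
  haveI : IsFiniteMeasure ((volume.restrict A).map (gr g)) := inferInstance
  haveI : IsFiniteMeasure (ν.map (Subtype.val : X → EuclideanSpace ℝ (Fin n))) := inferInstance
  refine ext_of_forall_integral_eq_of_IsFiniteMeasure fun h => ?_
  rw [integral_map (gr_measurable g).aemeasurable h.continuous.aestronglyMeasurable,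
    integral_map measurable_subtype_coe.aemeasurable h.continuous.aestronglyMeasurable]
  exact keq h

/-- transport from `A` to the density `f` on a ball -/
theorem ot_density {R : ℝ≥0} {A : Set (EuclideanSpace ℝ (Fin n))} (hA : IsCompact A)
    (hne : A.Nonempty) {f : EuclideanSpace ℝ (Fin n) → ℝ} (hf : Continuous f)
    (hpos : ∀ x, 0 < f x) (hR : 0 < R) :
    ∃ g : EuclideanSpace ℝ (Fin n) → ℝ, LipschitzWith R g ∧ ConvexOn ℝ Set.univ g ∧
      ∀ B, MeasurableSet B → volume (A ∩ gr g ⁻¹' B) =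
        ENNReal.ofReal ((volume A).toReal / ∫ x in Metric.closedBall 0 R, f x) *
          ∫⁻ x in B ∩ Metric.closedBall 0 R, ENNReal.ofReal (f x) := by
  set X : Set (EuclideanSpace ℝ (Fin n)) := Metric.closedBall 0 R with hX
  have hXc : IsCompact X := isCompact_closedBall _ _
  have hfi : IntegrableOn f X := hf.continuousOn.integrableOn_compact hXc
  have hI : 0 < ∫ x in X, f x := by
    rw [setIntegral_pos_iff_support_of_nonneg_ae (Eventually.of_forall fun x => (hpos x).le) hfi]
    have : Function.support f = Set.univ := by
      ext x; simp [(hpos x).ne']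
    rw [this, Set.univ_inter]
    exact Metric.measure_closedBall_pos _ _ (by exact_mod_cast hR)
  have hIl : ∫⁻ x in X, ENNReal.ofReal (f x) = ENNReal.ofReal (∫ x in X, f x) := by
    rw [ofReal_integral_eq_lintegral_ofReal hfi (Eventually.of_forall fun x => (hpos x).le)]
  set c : ℝ≥0∞ := ENNReal.ofReal ((volume A).toReal / ∫ x in X, f x) with hc
  set μ0 : Measure (EuclideanSpace ℝ (Fin n)) :=
    c • (volume.restrict X).withDensity fun x => ENNReal.ofReal (f x) with hμ0
  have hμapp : ∀ B, MeasurableSet B → μ0 B = c * ∫⁻ x in B ∩ X, ENNReal.ofReal (f x) := by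
    intro B hB
    rw [hμ0, Measure.smul_apply, withDensity_apply _ hB, Measure.restrict_restrict hB, smul_eq_mul]
  have hμuniv : μ0 Set.univ = volume A := by
    rw [hμapp _ MeasurableSet.univ, Set.univ_inter, hIl, hc, ← ENNReal.ofReal_mul (by positivity),
      div_mul_cancel₀ _ hI.ne', ENNReal.ofReal_toReal hA.measure_lt_top.ne]
  have hμc : μ0 Xᶜ = 0 := by
    rw [hμapp _ hXc.measurableSet.compl]; simp
  set ν : Measure X := μ0.comap Subtype.val with hν
  have hνm : ν.map Subtype.val = μ0 := by
    rw [hν, map_comap_subtype_coe hXc.measurableSet]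
    exact Measure.restrict_eq_self_of_ae_mem (by
      rw [ae_iff]; exact hμc)
  have hνu : ν Set.univ = volume A := by
    rw [← hμuniv, ← hνm, Measure.map_apply measurable_subtype_coe MeasurableSet.univ]
    simp
  haveI : IsFiniteMeasure ν := ⟨by rw [hνu]; exact hA.measure_lt_top⟩
  obtain ⟨g, h1, h2, h3⟩ := ot_map (R := R) hXc (by simp [hX])
    (fun y hy => by simpa [hX] using hy) hA hne ν hνu
  refine ⟨g, h1, h2, fun B hB => ?_⟩
  rw [← hμapp B hB, ← hνm, ← h3, Measure.map_apply (gr_measurable g) hB,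
    Measure.restrict_apply (gr_measurable g hB), Set.inter_comm]

end FirstVar

section Yosida
open Matrix Filter Topology
open scoped RealInnerProductSpace NNReal ENNReal BoundedContinuousFunction

variable {n : ℕ}

theorem yosida_strong {A : Set (EuclideanSpace ℝ (Fin n))} (hA : IsConvexBody A)
    {g : EuclideanSpace ℝ (Fin n) → ℝ} (hg : ConvexOn ℝ Set.univ g) (hgc : Continuous g) {δ : ℝ}
    {x : EuclideanSpace ℝ (Fin n)} {a : A}
    (ha : cj (fun a : A => g a + δ / 2 * ‖(a : EuclideanSpace ℝ (Fin n))‖ ^ 2) x =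
      ⟪(a : EuclideanSpace ℝ (Fin n)), x⟫ - (g a + δ / 2 * ‖(a : EuclideanSpace ℝ (Fin n))‖ ^ 2))
    (b : A) :
    ⟪(b : EuclideanSpace ℝ (Fin n)), x⟫ - (g b + δ / 2 * ‖(b : EuclideanSpace ℝ (Fin n))‖ ^ 2) +
      δ / 4 * ‖(a : EuclideanSpace ℝ (Fin n)) - b‖ ^ 2 ≤
    ⟪(a : EuclideanSpace ℝ (Fin n)), x⟫ - (g a + δ / 2 * ‖(a : EuclideanSpace ℝ (Fin n))‖ ^ 2) := by
  have hkc : Continuous (fun a : A => g a + δ / 2 * ‖(a : EuclideanSpace ℝ (Fin n))‖ ^ 2) := by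
    fun_prop
  obtain ⟨a, haA⟩ := a
  obtain ⟨b, hbA⟩ := b
  have hm : (1/2 : ℝ) • a + (1/2 : ℝ) • b ∈ A := hA.1 haA hbA (by norm_num) (by norm_num) (by norm_num)
  have h1 := le_cj hA.2.1 hkc x ⟨_, hm⟩
  rw [ha] at h1
  simp only at h1 ⊢
  have h2 := hg.2 (Set.mem_univ a) (Set.mem_univ b) (by norm_num : (0:ℝ) ≤ 1/2)
    (by norm_num : (0:ℝ) ≤ 1/2) (by norm_num)
  have h3 : ‖(1/2 : ℝ) • a + (1/2 : ℝ) • b‖ ^ 2 = ‖a‖^2/2 + ‖b‖^2/2 - ‖a - b‖^2/4 := by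
    rw [← real_inner_self_eq_norm_sq, ← real_inner_self_eq_norm_sq, ← real_inner_self_eq_norm_sq,
      ← real_inner_self_eq_norm_sq]
    simp only [inner_add_left, inner_add_right, inner_sub_left, inner_sub_right, inner_smul_left,
      inner_smul_right, real_inner_comm a b]
    simp
    ring
  rw [h3, inner_add_left, inner_smul_left, inner_smul_left] at h1
  simp only [smul_eq_mul] at h2
  simp at h1 h2
  linarith

theorem exists_yosida {A : Set (EuclideanSpace ℝ (Fin n))} (hA : IsConvexBody A)
    {g : EuclideanSpace ℝ (Fin n) → ℝ} (hg : ConvexOn ℝ Set.univ g) (hgc : Continuous g) {δ : ℝ}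
    (hδ : 0 < δ) :
    ∃ (ψ : EuclideanSpace ℝ (Fin n) → ℝ) (T : EuclideanSpace ℝ (Fin n) → EuclideanSpace ℝ (Fin n)),
      IsPot (interior A) ψ T ∧ (∀ x, T x ∈ A) ∧ LipschitzWith 1 (fun x => x - δ • T x) ∧
      ∀ x, T x ∈ interior A → DifferentiableAt ℝ g (T x) → gr g (T x) = x - δ • T x := by
  have hne : A.Nonempty := hA.2.2.mono interior_subset
  set k : A → ℝ := fun a : A => g a + δ / 2 * ‖(a : EuclideanSpace ℝ (Fin n))‖ ^ 2 with hk
  have hkc : Continuous k := by simp only [hk]; fun_prop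
  choose T hT using cj_exists hA.2.1 hne hkc
  have hst : ∀ x y, δ / 2 * ‖(T x : EuclideanSpace ℝ (Fin n)) - T y‖ ^ 2 ≤
      ⟪(T x : EuclideanSpace ℝ (Fin n)) - T y, x - y⟫ := by
    intro x y
    have h1 := yosida_strong hA hg hgc (hT x) (T y)
    have h2 := yosida_strong hA hg hgc (hT y) (T x)
    rw [norm_sub_rev] at h2
    rw [inner_sub_left, inner_sub_right, inner_sub_right]
    linarith
  have hlip : ∀ x y, ‖(T x : EuclideanSpace ℝ (Fin n)) - T y‖ ≤ 2 / δ * ‖x - y‖ := by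
    intro x y
    have h1 := hst x y
    have h2 := real_inner_le_norm ((T x : EuclideanSpace ℝ (Fin n)) - T y) (x - y)
    rcases (norm_nonneg ((T x : EuclideanSpace ℝ (Fin n)) - T y)).eq_or_lt with h0 | h0
    · rw [← h0]; positivity
    · rw [div_mul_eq_mul_div, le_div_iff₀ hδ]
      have : ‖(T x : EuclideanSpace ℝ (Fin n)) - T y‖ *
        (δ / 2 * ‖(T x : EuclideanSpace ℝ (Fin n)) - T y‖) ≤
        ‖(T x : EuclideanSpace ℝ (Fin n)) - T y‖ * ‖x - y‖ := by nlinarith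
      have := le_of_mul_le_mul_left this h0
      linarith
  refine ⟨cj k, fun x => T x, ⟨isOpen_interior, hA.1.interior, fun x => ?_, fun x => ?_,
    fun x y => ?_, ?_, fun p hp => ?_⟩, fun x => (T x).2, ?_, fun x hx hd => ?_⟩
  · have h0 : HasFDerivAt (fun y => cj k y - cj k x - ⟪(T x : EuclideanSpace ℝ (Fin n)), y - x⟫)
        (0 : EuclideanSpace ℝ (Fin n) →L[ℝ] ℝ) x := by
      refine Asymptotics.IsBigO.hasFDerivAt (n := 2) ?_ (by norm_num)
      refine Asymptotics.IsBigO.of_bound (2 / δ) (Eventually.of_forall fun y => ?_)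
      have h1 := cj_subgrad hA.2.1 hkc (hT x) y
      have h2 := cj_subgrad hA.2.1 hkc (hT y) x
      have h3 := real_inner_le_norm ((T y : EuclideanSpace ℝ (Fin n)) - T x) (y - x)
      have h4 := mul_le_mul_of_nonneg_right (hlip y x) (norm_nonneg (y - x))
      have e : x - y = -(y - x) := by abel
      rw [e, inner_neg_right] at h2
      rw [inner_sub_left] at h3
      rw [Real.norm_eq_abs, abs_of_nonneg (by linarith), norm_pow, norm_norm]
      nlinarith
    have h1 := (h0.add ((innerSL ℝ (T x : EuclideanSpace ℝ (Fin n))).hasFDerivAt (x := x))).add_const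
      (cj k x - ⟪(T x : EuclideanSpace ℝ (Fin n)), x⟫)
    rw [zero_add] at h1
    refine h1.congr_of_eventuallyEq (Eventually.of_forall fun y => ?_)
    simp [inner_sub_right]
    ring
  · rw [hA.1.closure_interior_eq_closure_of_nonempty_interior hA.2.2]
    exact subset_closure (T x).2
  · exact (by positivity : (0:ℝ) ≤ _).trans (hst x y)
  · refine ⟨Real.toNNReal (2 / δ), LipschitzWith.of_dist_le_mul fun x y => ?_⟩
    rw [Real.coe_toNNReal _ (by positivity), dist_eq_norm, dist_eq_norm]
    exact hlip x y
  · obtain ⟨r, hr, hrA⟩ := Metric.nhds_basis_closedBall.mem_iff.1 (isOpen_interior.mem_nhds hp)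
    haveI := isCompact_iff_compactSpace.1 hA.2.1
    obtain ⟨M, hM⟩ := (isCompact_range hkc).bddAbove
    have hM' : ∀ a, k a ≤ M := fun a => hM ⟨a, rfl⟩
    have ht : Tendsto (fun x : EuclideanSpace ℝ (Fin n) => r * ‖x‖ + (-M)) (cocompact _) atTop :=
      tendsto_atTop_add_const_right _ _ (tendsto_norm_cocompact_atTop.const_mul_atTop hr)
    refine tendsto_atTop_mono (fun x => ?_) ht
    have hq : p + (r / ‖x‖) • x ∈ A := by
      refine interior_subset (hrA ?_)
      rw [Metric.mem_closedBall, dist_eq_norm, add_sub_cancel_left, norm_smul, Real.norm_eq_abs,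
        abs_of_nonneg (by positivity)]
      rcases eq_or_ne ‖x‖ 0 with h0 | h0
      · rw [h0]; simpa using hr.le
      · rw [div_mul_cancel₀ _ h0]
    have h1 := le_cj hA.2.1 hkc x ⟨_, hq⟩
    have h2 := hM' ⟨_, hq⟩
    simp only [inner_add_left, inner_smul_left] at h1
    have h3 : (r / ‖x‖) * ⟪x, x⟫ = r * ‖x‖ := by
      rw [real_inner_self_eq_norm_sq]
      rcases eq_or_ne ‖x‖ 0 with h0 | h0
      · rw [h0]; simp
      · field_simp
    simp at h1
    simp at h3
    linarith
  · refine LipschitzWith.of_dist_le_mul fun x y => ?_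
    rw [dist_eq_norm, dist_eq_norm, NNReal.coe_one, one_mul]
    have e : x - δ • (T x : EuclideanSpace ℝ (Fin n)) - (y - δ • (T y : EuclideanSpace ℝ (Fin n))) =
      (x - y) - δ • ((T x : EuclideanSpace ℝ (Fin n)) - T y) := by rw [smul_sub]; abel
    rw [e]
    refine (pow_le_pow_iff_left₀ (norm_nonneg _) (norm_nonneg _) two_ne_zero).1 ?_
    rw [norm_sub_sq_real, inner_smul_right, norm_smul, Real.norm_eq_abs, abs_of_pos hδ, mul_pow]
    have := hst x y
    rw [real_inner_comm]
    nlinarith [mul_le_mul_of_nonneg_left this hδ.le]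
  · set a : EuclideanSpace ℝ (Fin n) := (T x : EuclideanSpace ℝ (Fin n)) with ha
    have hmin : IsLocalMin (fun b => g b + δ / 2 * ‖b‖ ^ 2 - ⟪x, b⟫) a := by
      filter_upwards [isOpen_interior.mem_nhds hx] with b hb
      have h1 := le_cj hA.2.1 hkc x ⟨b, interior_subset hb⟩
      rw [hT x] at h1
      simp only [hk, ← ha] at h1
      rw [real_inner_comm, real_inner_comm b]
      linarith
    have h1 : HasFDerivAt (fun b => g b + δ / 2 * ‖b‖ ^ 2 - ⟪x, b⟫)
        (fderiv ℝ g a + (δ / 2) • (2 • (innerSL ℝ a)) - innerSL ℝ x) a :=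
      (hd.hasFDerivAt.add ((hasStrictFDerivAt_norm_sq a).hasFDerivAt.const_mul (δ / 2))).sub
        (innerSL ℝ x).hasFDerivAt
    have h0 := hmin.hasFDerivAt_eq_zero h1
    have h2 : fderiv ℝ g a = innerSL ℝ (x - δ • a) := by
      ext w
      have := DFunLike.congr_fun h0 w
      simp [inner_sub_left, inner_smul_left] at this ⊢
      linarith
    rw [gr, h2, LinearIsometryEquiv.symm_apply_eq]
    ext w
    simp
    exact Or.inl rfl

theorem IsPot.area_le {O : Set (EuclideanSpace ℝ (Fin n))} {φ : EuclideanSpace ℝ (Fin n) → ℝ}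
    {G : EuclideanSpace ℝ (Fin n) → EuclideanSpace ℝ (Fin n)} (h : IsPot O φ G)
    {E : Set (EuclideanSpace ℝ (Fin n))} (hE : MeasurableSet E) :
    ∫⁻ x in E, ENNReal.ofReal (Hm G x).det ≤ volume (G '' E) := by
  set N' : Set (EuclideanSpace ℝ (Fin n)) :=
      {x | DifferentiableAt ℝ G x ∧ (fderiv ℝ G x).det ≠ 0} with hN'
  have hmd : Measurable fun x => (fderiv ℝ G x).det :=
    ContinuousLinearMap.continuous_det.measurable.comp (measurable_fderiv ℝ G)
  have hN'm : MeasurableSet N' := (measurableSet_of_differentiableAt ℝ G).inter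
    (hmd (measurableSet_singleton (0:ℝ)).compl)
  have e : ∫⁻ x in E, ENNReal.ofReal (Hm G x).det ≤
      ∫⁻ x in E ∩ N', ENNReal.ofReal |(fderiv ℝ G x).det| := by
    rw [← lintegral_indicator hE, ← lintegral_indicator (hE.inter hN'm)]
    refine lintegral_mono_ae ?_
    filter_upwards [h.ae_diff] with x hx
    by_cases hxE : x ∈ E
    · by_cases hx2 : (fderiv ℝ G x).det = 0
      · simp [Set.indicator, hN', hx, hx2, hxE, Hm_det]
      · simp only [Set.indicator, hN', Set.mem_inter_iff, Set.mem_ofPred_eq, hx, hx2, hxE, Hm_det]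
        rw [if_pos trivial, if_pos ⟨trivial, trivial, hx2⟩]
        exact ENNReal.ofReal_le_ofReal (le_abs_self _)
    · simp [Set.indicator, hxE]
  refine e.trans ?_
  rw [lintegral_abs_det_fderiv_eq_addHaar_image volume (hE.inter hN'm)
      (fun x hx => hx.2.1.hasFDerivAt.hasFDerivWithinAt) (h.injOn.mono Set.inter_subset_right)]
  exact measure_mono (Set.image_mono Set.inter_subset_left)

end Yosida

section TransportPot
open Matrix Filter Topology
open scoped RealInnerProductSpace NNReal ENNReal BoundedContinuousFunction

variable {n : ℕ}

theorem IsPot.integrable_det (hn : 1 ≤ n) {A : Set (EuclideanSpace ℝ (Fin n))} (hA : IsConvexBody A)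
    {φ : EuclideanSpace ℝ (Fin n) → ℝ}
    {G : EuclideanSpace ℝ (Fin n) → EuclideanSpace ℝ (Fin n)} (h : IsPot (interior A) φ G) :
    Integrable (fun x => (Hm G x).det) ∧ ∫ x, (Hm G x).det = (volume A).toReal := by
  have := pot_sum_det hn (K := fun _ => A) (fun _ => hA) (φ := fun _ => φ) (G := fun _ => G)
    (fun _ => h) {⟨0, hn⟩}
  simpa using this

theorem exists_modulus {f : EuclideanSpace ℝ (Fin n) → ℝ} (hf : Continuous f)
    (hpos : ∀ x, 0 < f x) (R : ℝ≥0) {ε : ℝ} (hε : 0 < ε) :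
    ∃ η > 0, ∀ x, ∀ z ∈ Metric.closedBall (0 : EuclideanSpace ℝ (Fin n)) R, dist z x < η →
      f z ≤ (1 + ε) * f x := by
  set X1 : Set (EuclideanSpace ℝ (Fin n)) := Metric.closedBall 0 (R + 1) with hX1
  have hXc : IsCompact X1 := isCompact_closedBall _ _
  have hne : X1.Nonempty := ⟨0, by simp only [hX1, Metric.mem_closedBall, dist_self]; positivity⟩
  obtain ⟨x0, hx0, hmin⟩ := hXc.exists_isMinOn hne hf.continuousOn
  have hu := hXc.uniformContinuousOn_of_continuous hf.continuousOn
  rw [Metric.uniformContinuousOn_iff] at hu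
  obtain ⟨η, hη, hu⟩ := hu (ε * f x0) (mul_pos hε (hpos x0))
  refine ⟨min η 1, lt_min hη one_pos, fun x z hz hd => ?_⟩
  have hz' : ‖z‖ ≤ R := by simpa using hz
  have hd1 := hd.trans_le (min_le_right _ _)
  have hzX : z ∈ X1 := by simp only [hX1, mem_closedBall_zero_iff]; linarith
  have hxX : x ∈ X1 := by
    simp only [hX1, mem_closedBall_zero_iff]
    have : ‖x‖ ≤ ‖z‖ + dist z x := by
      rw [dist_eq_norm]
      have e : x = z - (z - x) := by abel
      calc ‖x‖ = ‖z - (z - x)‖ := by rw [← e]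
        _ ≤ _ := norm_sub_le _ _
    linarith
  have h1 := hu z hzX x hxX (hd.trans_le (min_le_left _ _))
  rw [Real.dist_eq] at h1
  have h2 := (abs_lt.1 h1).2
  have h3 : f x0 ≤ f x := hmin hxX
  nlinarith [mul_le_mul_of_nonneg_left h3 hε.le]

theorem exists_transport_pot (hn : 1 ≤ n) {A : Set (EuclideanSpace ℝ (Fin n))}
    (hA : IsConvexBody A) {f : EuclideanSpace ℝ (Fin n) → ℝ} (hf : Continuous f)
    (hpos : ∀ x, 0 < f x) {R : ℝ≥0} (hR : 0 < R) {ε : ℝ} (hε : 0 < ε) :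
    ∃ ψ T, IsPot (interior A) ψ T ∧ ∀ᵐ x, (Hm T x).det ≤
      ((volume A).toReal / ∫ x in Metric.closedBall 0 R, f x) * ((1 + ε) * f x) := by
  obtain ⟨η, hη, hmod⟩ := exists_modulus hf hpos R hε
  obtain ⟨D, hD⟩ := hA.2.1.exists_bound_of_continuousOn (f := fun y => y) continuousOn_id
  have hne : A.Nonempty := hA.2.2.mono interior_subset
  have hD0 : 0 ≤ D := (norm_nonneg _).trans (hD _ hne.some_mem)
  obtain ⟨g, hgl, hgc, hgm⟩ := ot_density hA.2.1 hne hf hpos hR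
  set c : ℝ := (volume A).toReal / ∫ x in Metric.closedBall 0 R, f x with hc
  have hc0 : 0 ≤ c := div_nonneg ENNReal.toReal_nonneg (integral_nonneg fun x => (hpos x).le)
  set δ : ℝ := η / (4 * (D + 1)) with hδ
  have hδ0 : 0 < δ := by positivity
  have hδD : δ * D ≤ η / 4 := by
    rw [hδ, div_mul_eq_mul_div, div_le_div_iff₀ (by positivity) (by norm_num)]
    nlinarith
  obtain ⟨ψ, T, hT, hTA, hJ, hgr⟩ := exists_yosida hA hgc hgl.continuous hδ0
  refine ⟨ψ, T, hT, ?_⟩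
  obtain ⟨hIntg, -⟩ := hT.integrable_det hn hA
  have hball : ∀ x r, r ≤ η / 2 → volume (T '' Metric.closedBall x r) ≤
      ENNReal.ofReal (c * ((1 + ε) * f x)) * volume (Metric.closedBall x r) := by
    intro x r hr
    set E := Metric.closedBall x r with hE
    set J : EuclideanSpace ℝ (Fin n) → EuclideanSpace ℝ (Fin n) := fun x => x - δ • T x with hJd
    have hEc : IsCompact E := isCompact_closedBall _ _
    have hJE : MeasurableSet (J '' E) := (hEc.image hJ.continuous).measurableSet
    have hsub : T '' E ⊆ (A ∩ gr g ⁻¹' (J '' E)) ∪ (frontier A ∪ {a | ¬ DifferentiableAt ℝ g a}) := by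
      rintro _ ⟨y, hy, rfl⟩
      by_cases h1 : T y ∈ interior A
      · by_cases h2 : DifferentiableAt ℝ g (T y)
        · refine Or.inl ⟨hTA y, ?_⟩
          rw [Set.mem_preimage, hgr y h1 h2]
          exact ⟨y, hy, rfl⟩
        · exact Or.inr (Or.inr h2)
      · exact Or.inr (Or.inl ⟨subset_closure (hTA y), h1⟩)
    have hnull : volume (frontier A ∪ {a | ¬ DifferentiableAt ℝ g a}) = 0 := by
      refine measure_union_null (hA.1.addHaar_frontier volume) ?_
      have := hgl.ae_differentiableAt (μ := volume)
      rwa [ae_iff] at this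
    have hfb : ∀ z ∈ J '' E ∩ Metric.closedBall 0 R, ENNReal.ofReal (f z) ≤
        ENNReal.ofReal ((1 + ε) * f x) := by
      rintro _ ⟨⟨y, hy, rfl⟩, hz⟩
      refine ENNReal.ofReal_le_ofReal (hmod x _ hz ?_)
      rw [dist_eq_norm]
      have hy' : ‖y - x‖ ≤ r := by rw [← dist_eq_norm]; exact hy
      have e : J y - x = (y - x) - δ • T y := by simp only [hJd]; abel
      rw [e]
      have h1 := norm_sub_le (y - x) (δ • T y)
      rw [norm_smul, Real.norm_eq_abs, abs_of_pos hδ0] at h1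
      have h2 := mul_le_mul_of_nonneg_left (hD _ (hTA y)) hδ0.le
      linarith
    have hJv : volume (J '' E) ≤ volume E := by
      have := volume_image_lipschitz_le (hJ.lipschitzOnWith (s := E))
      simpa using this
    calc volume (T '' E) ≤ volume (A ∩ gr g ⁻¹' (J '' E)) +
          volume (frontier A ∪ {a | ¬ DifferentiableAt ℝ g a}) :=
          (measure_mono hsub).trans (measure_union_le _ _)
      _ = ENNReal.ofReal c * ∫⁻ z in J '' E ∩ Metric.closedBall 0 R, ENNReal.ofReal (f z) := by
          rw [hnull, add_zero, hgm _ hJE]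
      _ ≤ ENNReal.ofReal c * ∫⁻ z in J '' E ∩ Metric.closedBall 0 R,
            ENNReal.ofReal ((1 + ε) * f x) := by
          refine mul_le_mul' le_rfl ?_
          exact setLIntegral_mono' (hJE.inter Metric.isClosed_closedBall.measurableSet) hfb
      _ ≤ ENNReal.ofReal c * (ENNReal.ofReal ((1 + ε) * f x) * volume E) := by
          refine mul_le_mul' le_rfl ?_
          rw [setLIntegral_const]
          refine mul_le_mul' le_rfl ?_
          exact (measure_mono Set.inter_subset_left).trans hJv
      _ = _ := by rw [← mul_assoc, ← ENNReal.ofReal_mul hc0]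
  have hav : ∀ x r, 0 < r → r ≤ η / 2 → ⨍ y in Metric.closedBall x r, (Hm T y).det ≤
      c * ((1 + ε) * f x) := by
    intro x r hr0 hr
    have hC : 0 ≤ c * ((1 + ε) * f x) := by
      have := (hpos x).le
      positivity
    have h1 := (hT.area_le (Metric.isClosed_closedBall (x := x) (ε := r)).measurableSet).trans
      (hball x r hr)
    have hv0 : 0 < volume (Metric.closedBall x r) := Metric.measure_closedBall_pos _ _ hr0
    have hvt : volume (Metric.closedBall x r) < ⊤ := (isCompact_closedBall x r).measure_lt_top
    rw [← ofReal_integral_eq_lintegral_ofReal hIntg.integrableOn (ae_restrict_of_ae (by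
      filter_upwards [hT.ae_diff] with y hy using (hT.Hm_psd hy).det_nonneg)),
      ← ENNReal.ofReal_toReal hvt.ne, ← ENNReal.ofReal_mul hC,
      ENNReal.ofReal_le_ofReal_iff (by positivity)] at h1
    rw [setAverage_eq, smul_eq_mul, Measure.real, inv_mul_le_iff₀ (ENNReal.toReal_pos hv0.ne' hvt.ne)]
    linarith
  filter_upwards [IsUnifLocDoublingMeasure.ae_tendsto_average volume hIntg.locallyIntegrable 1] with x hx
  have ht : Tendsto (fun j : ℕ => (η / 2) * (1 / ((j : ℝ) + 1))) atTop (𝓝[>] 0) := by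
    refine tendsto_nhdsWithin_iff.2 ⟨?_, Eventually.of_forall fun j => ?_⟩
    · have := (tendsto_one_div_add_atTop_nhds_zero_nat (𝕜 := ℝ)).const_mul (η / 2)
      simpa using this
    · rw [Set.mem_Ioi]; positivity
  have hl := hx (fun _ => x) _ ht (Eventually.of_forall fun j => by
    rw [Metric.mem_closedBall, dist_self]; positivity)
  refine le_of_tendsto' hl fun j => hav x _ (by positivity) ?_
  have : 1 / ((j : ℝ) + 1) ≤ 1 := by
    rw [div_le_one (by positivity)]
    have : (0:ℝ) ≤ j := Nat.cast_nonneg j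
    linarith
  nlinarith

end TransportPot

section MainGen
open Matrix Filter Topology
open scoped RealInnerProductSpace NNReal ENNReal

variable {n : ℕ}

theorem holder_prod {κ : Type*} [Fintype κ] [Nonempty κ] {u : κ → EuclideanSpace ℝ (Fin n) → ℝ}
    {d : EuclideanSpace ℝ (Fin n) → ℝ} {c : ℝ} (hc : 0 ≤ c)
    (hu : ∀ k, Integrable (u k)) (hu0 : ∀ k, ∀ᵐ x, 0 ≤ u k x) (hd : Integrable d)
    (hd0 : ∀ᵐ x, 0 ≤ d x) (h : ∀ᵐ x, c * d x ^ Fintype.card κ ≤ ∏ k, u k x) :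
    c * (∫ x, d x) ^ Fintype.card κ ≤ ∏ k, ∫ x, u k x := by
  set N := Fintype.card κ with hN
  have hN0 : N ≠ 0 := Fintype.card_ne_zero
  have hNp : (0 : ℝ) ≤ ((N : ℝ))⁻¹ := by positivity
  have hpt : ∀ᵐ x, ENNReal.ofReal c ^ ((N : ℝ))⁻¹ * ENNReal.ofReal (d x) ≤
      ∏ k, ENNReal.ofReal (u k x) ^ ((N : ℝ))⁻¹ := by
    filter_upwards [h, hd0, ae_all_iff.2 hu0] with x h1 h2 h3
    rw [ENNReal.prod_rpow_of_nonneg hNp, ← ENNReal.ofReal_prod_of_nonneg fun k _ => h3 k]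
    calc _ = (ENNReal.ofReal (c * d x ^ N)) ^ ((N : ℝ))⁻¹ := by
          rw [ENNReal.ofReal_mul hc, ENNReal.ofReal_pow h2, ENNReal.mul_rpow_of_nonneg _ _ hNp,
            ENNReal.pow_rpow_inv_natCast hN0]
      _ ≤ _ := ENNReal.rpow_le_rpow (ENNReal.ofReal_le_ofReal h1) hNp
  have h1 := lintegral_mono_ae hpt
  rw [lintegral_const_mul'' _ hd.aemeasurable.ennreal_ofReal,
    ← ofReal_integral_eq_lintegral_ofReal hd hd0] at h1
  have h2 := h1.trans (ENNReal.lintegral_prod_norm_pow_le Finset.univ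
    (fun k _ => (hu k).aemeasurable.ennreal_ofReal) (p := fun _ => ((N : ℝ))⁻¹)
    (by rw [Finset.sum_const, Finset.card_univ, ← hN, nsmul_eq_mul, mul_inv_cancel₀ (by exact_mod_cast hN0)])
    (fun _ _ => hNp))
  rw [ENNReal.prod_rpow_of_nonneg hNp] at h2
  have h3 := pow_le_pow_left' h2 N
  rw [mul_pow, ENNReal.rpow_inv_natCast_pow hN0, ENNReal.rpow_inv_natCast_pow hN0,
    ← ENNReal.ofReal_pow (integral_nonneg_of_ae hd0), ← ENNReal.ofReal_mul hc] at h3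
  have h4 : ∏ k, ∫⁻ x, ENNReal.ofReal (u k x) = ENNReal.ofReal (∏ k, ∫ x, u k x) := by
    rw [ENNReal.ofReal_prod_of_nonneg fun k _ => integral_nonneg_of_ae (hu0 k)]
    exact Finset.prod_congr rfl fun k _ => (ofReal_integral_eq_lintegral_ofReal (hu k) (hu0 k)).symm
  rw [h4, ENNReal.ofReal_le_ofReal_iff
    (Finset.prod_nonneg fun k _ => integral_nonneg_of_ae (hu0 k))] at h3
  exact h3

theorem volume_pos_body {A : Set (EuclideanSpace ℝ (Fin n))} (hA : IsConvexBody A) :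
    0 < (volume A).toReal :=
  ENNReal.toReal_pos ((isOpen_interior.measure_pos volume hA.2.2).trans_le
    (measure_mono interior_subset)).ne' hA.2.1.measure_lt_top.ne

set_option maxHeartbeats 1600000 in
theorem main_gen (hn : 1 ≤ n) {κ : Type*} [Fintype κ] [LinearOrder κ] [Nonempty κ] (γ : Fin n → κ)
    (hκ : 2 ≤ Fintype.card κ) {A : Set (EuclideanSpace ℝ (Fin n))} (hA : IsConvexBody A)
    {L : Fin n → Set (EuclideanSpace ℝ (Fin n))} (hL : ∀ j, IsConvexBody (L j)) :
    (n.factorial * mixedVolume L) * (volume A).toReal ^ (Fintype.card κ - 1) ≤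
      ∏ k, ((n.factorial * mixedVolume (fun j => if γ j = k then L j else A)) /
        ((n - Fintype.card {i // γ i = k}).factorial : ℝ)) := by
  choose φ G hpot hsm hpd using fun j => exists_smooth_pot (hL j)
  set f : EuclideanSpace ℝ (Fin n) → ℝ := fun x => ydisc fun j => Hm (G j) x with hf
  have hfc : Continuous f := by
    simp only [hf, ydisc]
    refine continuous_finset_sum _ fun σ _ => Continuous.matrix_det ?_
    refine continuous_matrix fun i j => ?_
    exact (Hm_continuous (hsm (σ i))).matrix_elem i j
  have hfpos : ∀ x, 0 < f x := fun x => ydisc_pos _ fun j => hpd j x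
  obtain ⟨hfi, hfI⟩ := ydisc_Hm_integral hn hL hpot
  set P : ℝ := ∏ k, ((n.factorial * mixedVolume (fun j => if γ j = k then L j else A)) /
        ((n - Fintype.card {i // γ i = k}).factorial : ℝ)) with hP
  set N := Fintype.card κ with hN
  have hvol := volume_pos_body hA
  have key : ∀ R : ℝ≥0, 0 < R → ∀ ε : ℝ, 0 < ε →
      (∫ x in Metric.closedBall 0 R, f x) * (volume A).toReal ^ (N - 1) ≤ (1 + ε) * P := by
    intro R hR ε hε
    obtain ⟨ψ, T, hT, hdet⟩ := exists_transport_pot hn hA hfc hfpos hR hε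
    obtain ⟨hdi, hdI⟩ := hT.integrable_det hn hA
    set I := ∫ x in Metric.closedBall 0 R, f x with hI
    have hI0 : 0 ≤ I := integral_nonneg fun x => (hfpos x).le
    rcases hI0.eq_or_lt with hI00 | hI0
    · have hP0 : 0 ≤ P := by
        refine Finset.prod_nonneg fun k _ => div_nonneg ?_ (by positivity)
        have hbod : ∀ j, IsConvexBody (if γ j = k then L j else A) := fun j => by
          split_ifs
          exacts [hL j, hA]
        choose φ' G' hpot' _ _ using fun j => exists_smooth_pot (hbod j)
        rw [← (ydisc_Hm_integral hn hbod hpot').2]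
        exact integral_nonneg_of_ae (ydisc_Hm_nonneg hpot')
      rw [← hI00, zero_mul]
      exact mul_nonneg (by linarith) hP0
    have hb : ∀ k j, IsConvexBody (if γ j = k then L j else A) := fun k j => by
      split_ifs
      exacts [hL j, hA]
    have hb2 : ∀ k j, IsPot (interior (if γ j = k then L j else A)) (if γ j = k then φ j else ψ)
        (if γ j = k then G j else T) := fun k j => by
      by_cases hkj : γ j = k
      · simp only [hkj, if_true]; exact hpot j
      · simp only [hkj, if_false]; exact hT
    have hyk : ∀ k x, (fun j => Hm (if γ j = k then G j else T) x) =
        fun j => if γ j = k then Hm (G j) x else Hm T x := fun k x => by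
      funext j; split_ifs <;> rfl
    set u : κ → EuclideanSpace ℝ (Fin n) → ℝ := fun k x =>
      (ydisc fun j => Hm (if γ j = k then G j else T) x) /
        ((n - Fintype.card {i // γ i = k}).factorial : ℝ) with hu
    have hui : ∀ k, Integrable (u k) := fun k =>
      (ydisc_Hm_integral hn (hb k) (hb2 k)).1.div_const _
    have huI : ∀ k, ∫ x, u k x = ((n.factorial * mixedVolume (fun j => if γ j = k then L j else A)) /
        ((n - Fintype.card {i // γ i = k}).factorial : ℝ)) := fun k => by
      simp only [hu]
      rw [integral_div, (ydisc_Hm_integral hn (hb k) (hb2 k)).2]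
    have hu0 : ∀ k, ∀ᵐ x, 0 ≤ u k x := fun k => by
      filter_upwards [ydisc_Hm_nonneg (hb2 k)] with x hx
      exact div_nonneg hx (by positivity)
    have hd0 : ∀ᵐ x, 0 ≤ (Hm T x).det := by
      filter_upwards [hT.ae_diff] with y hy using (hT.Hm_psd hy).det_nonneg
    set c : ℝ := I / ((volume A).toReal * (1 + ε)) with hc
    have hc0 : 0 ≤ c := by positivity
    have hmain := holder_prod hc0 hui hu0 hdi hd0 (by
      filter_upwards [hT.ae_diff, hd0, hdet] with x hx h0 hle
      have h1 := ydisc_pointwise γ hκ (fun j => Hm (G j) x) (fun j => (hpd j x).posSemidef)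
        (Hm T x) (hT.Hm_psd hx)
      simp only [Fintype.card_fin] at h1
      have h2 : c * (Hm T x).det ≤ f x := by
        rw [hc, div_mul_eq_mul_div, div_le_iff₀ (by positivity)]
        have := mul_le_mul_of_nonneg_left hle hI0.le
        have e : I * ((volume A).toReal / I * ((1 + ε) * f x)) =
          f x * ((volume A).toReal * (1 + ε)) := by field_simp
        linarith
      calc c * (Hm T x).det ^ Fintype.card κ =
            (c * (Hm T x).det) * (Hm T x).det ^ (Fintype.card κ - 1) := by
            rw [mul_assoc, ← pow_succ', Nat.sub_add_cancel (by omega)]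
        _ ≤ f x * (Hm T x).det ^ (Fintype.card κ - 1) :=
            mul_le_mul_of_nonneg_right h2 (by positivity)
        _ ≤ _ := by
            refine h1.trans (le_of_eq ?_)
            refine Finset.prod_congr rfl fun k _ => ?_
            simp only [hu, hyk])
    rw [hdI] at hmain
    simp only [huI] at hmain
    rw [← hP, hc, div_mul_eq_mul_div, div_le_iff₀ (by positivity)] at hmain
    have e : (volume A).toReal ^ Fintype.card κ = (volume A).toReal ^ (N - 1) * (volume A).toReal := by
      rw [← pow_succ, Nat.sub_add_cancel (by omega)]
    rw [e] at hmain
    refine le_of_mul_le_mul_right ?_ hvol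
    linarith
  have key2 : ∀ R : ℝ≥0, 0 < R →
      (∫ x in Metric.closedBall 0 R, f x) * (volume A).toReal ^ (N - 1) ≤ P := by
    intro R hR
    have ht : Tendsto (fun ε : ℝ => (1 + ε) * P) (𝓝[>] 0) (𝓝 P) := by
      have : Tendsto (fun ε : ℝ => (1 + ε) * P) (𝓝 0) (𝓝 ((1 + 0) * P)) :=
        (by fun_prop : Continuous fun ε : ℝ => (1 + ε) * P).tendsto 0
      rw [add_zero, one_mul] at this
      exact this.mono_left nhdsWithin_le_nhds
    refine ge_of_tendsto ht ?_
    filter_upwards [self_mem_nhdsWithin] with ε hε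
    exact key R hR ε hε
  rw [← hfI]
  have hlim : Tendsto (fun j : ℕ => ∫ x in Metric.closedBall 0 ((j : ℝ) + 1), f x) atTop
      (𝓝 (∫ x, f x)) :=
    (aecover_closedBall (x := (0 : EuclideanSpace ℝ (Fin n))) (μ := volume)
      (tendsto_atTop_add_const_right _ 1 tendsto_natCast_atTop_atTop)).integral_tendsto_of_countably_generated hfi
  refine le_of_tendsto' (hlim.mul_const _) fun j => ?_
  have := key2 ((j : ℝ≥0) + 1) (by positivity)
  simpa using this

end MainGen

section Bookkeeping

variable {n : ℕ}

theorem mixedVolume_comp_perm (F : Fin n → Set (EuclideanSpace ℝ (Fin n)))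
    (σ : Equiv.Perm (Fin n)) : mixedVolume (fun j => F (σ j)) = mixedVolume F := by
  unfold mixedVolume
  congr 1
  refine Fintype.sum_equiv (Equiv.finsetCongr σ) _ _ fun S => ?_
  simp only [Equiv.finsetCongr_apply, Finset.card_map, Finset.sum_map, Equiv.coe_toEmbedding]

theorem card_fiber_ofFn {α : Type*} (f : Fin n → α) (p : α → Prop) [DecidablePred p] :
    Fintype.card {j // p (f j)} = (List.ofFn f).countP (fun a => decide (p a)) := by
  rw [Fintype.card_subtype, ← Multiset.coe_countP, ← Fin.univ_val_map, Multiset.countP_map]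
  rfl

theorem mixedVolume_of_perm {F F' : Fin n → Set (EuclideanSpace ℝ (Fin n))}
    (h : (List.ofFn F).Perm (List.ofFn F')) : mixedVolume F = mixedVolume F' := by
  classical
  have hc : ∀ a, Fintype.card {j // F j = a} = Fintype.card {j // F' j = a} := fun a => by
    rw [card_fiber_ofFn F (fun b => b = a), card_fiber_ofFn F' (fun b => b = a)]
    exact h.countP_eq _
  let e : ∀ a, {j // F j = a} ≃ {j // F' j = a} := fun a => Fintype.equivOfCardEq (hc a)
  let σ : Equiv.Perm (Fin n) := (Equiv.sigmaFiberEquiv F).symm.trans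
    ((Equiv.sigmaCongrRight e).trans (Equiv.sigmaFiberEquiv F'))
  have hσ : ∀ j, F' (σ j) = F j := fun j => (e (F j) ⟨j, rfl⟩).2
  rw [← mixedVolume_comp_perm F' σ]
  congr 1
  funext j
  exact (hσ j).symm

theorem ofFn_getD {α : Type*} {l : List α} (hl : l.length = n) (d : α) :
    List.ofFn (fun j : Fin n => l.getD (j : ℕ) d) = l := by
  subst hl
  refine List.ext_getElem (by simp) fun i h1 h2 => ?_
  simp

theorem ofFn_ite {α : Type*} {i : ℕ} (hi : i ≤ n) (a b : α) :
    List.ofFn (fun j : Fin n => if (j : ℕ) < i then a else b) =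
      List.replicate i a ++ List.replicate (n - i) b := by
  refine List.ext_getElem (by simp; omega) fun j h1 h2 => ?_
  simp [List.getElem_append]

/-- labelled list of bodies -/
def labelled {α : Type*} {m r : ℕ} (i : Fin m → ℕ) (B : Fin m → α) (K : Fin r → α) :
    List (Fin (m + 1) × α) :=
  blocks i (fun k => (k.succ, B k)) ++ List.ofFn fun j => ((0 : Fin (m + 1)), K j)

theorem labelled_snd {α : Type*} {m r : ℕ} (i : Fin m → ℕ) (B : Fin m → α) (K : Fin r → α) :
    (labelled i B K).map Prod.snd = blocks i B ++ List.ofFn K := by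
  simp only [labelled, blocks, List.map_append, List.map_flatten, List.map_ofFn]
  congr 3
  funext k
  simp

theorem labelled_mem {α : Type*} {m r : ℕ} (i : Fin m → ℕ) (B : Fin m → α) (K : Fin r → α)
    {p : Fin (m + 1) × α} (hp : p ∈ labelled i B K) :
    (∃ k, p = (k.succ, B k)) ∨ ∃ j, p = (0, K j) := by
  simp only [labelled, blocks, List.mem_append, List.mem_flatten, List.mem_ofFn] at hp
  rcases hp with ⟨l, ⟨k, rfl⟩, hp⟩ | ⟨j, rfl⟩
  · exact Or.inl ⟨k, (List.eq_of_mem_replicate hp)⟩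
  · exact Or.inr ⟨j, rfl⟩

theorem labelled_length {α : Type*} {m r : ℕ} (i : Fin m → ℕ) (B : Fin m → α) (K : Fin r → α) :
    (labelled i B K).length = ∑ k, i k + r := by
  simp only [labelled, blocks, List.length_append, List.length_flatten, List.map_ofFn,
    List.length_ofFn, List.sum_ofFn]
  simp

theorem labelled_count_succ {α : Type*} {m r : ℕ} (i : Fin m → ℕ) (B : Fin m → α) (K : Fin r → α)
    (k : Fin m) : (labelled i B K).countP (fun p => decide (p.1 = k.succ)) = i k := by
  simp only [labelled, blocks, List.countP_append, List.countP_flatten, List.map_ofFn, List.sum_ofFn]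
  have h2 : (List.ofFn fun j => ((0 : Fin (m + 1)), K j)).countP
      (fun p => decide (p.1 = k.succ)) = 0 := by
    rw [List.countP_eq_zero]
    intro p hp
    obtain ⟨j, rfl⟩ := List.mem_ofFn.1 hp
    simpa using (Fin.succ_ne_zero k).symm
  rw [h2, add_zero]
  simp [List.countP_replicate, Finset.sum_ite_eq']

theorem labelled_filter_zero {α : Type*} {m r : ℕ} (i : Fin m → ℕ) (B : Fin m → α) (K : Fin r → α) :
    (labelled i B K).filter (fun p => decide (p.1 = 0)) =
      List.ofFn fun j => ((0 : Fin (m + 1)), K j) := by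
  simp only [labelled, List.filter_append]
  have h1 : (blocks i (fun k => (k.succ, B k))).filter (fun p => decide (p.1 = 0)) = [] := by
    rw [List.filter_eq_nil_iff]
    intro p hp
    simp only [blocks, List.mem_flatten, List.mem_ofFn] at hp
    obtain ⟨l, ⟨k, rfl⟩, hp⟩ := hp
    rw [List.eq_of_mem_replicate hp]
    simp
  have h2 : (List.ofFn fun j => ((0 : Fin (m + 1)), K j)).filter (fun p => decide (p.1 = 0)) =
      List.ofFn fun j => ((0 : Fin (m + 1)), K j) := by
    rw [List.filter_eq_self]
    intro p hp
    obtain ⟨j, rfl⟩ := List.mem_ofFn.1 hp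
    simp
  rw [h1, h2, List.nil_append]

theorem map_ite_perm {α β : Type*} (l : List (β × α)) [DecidableEq β] (k : β) (a : α) :
    (l.map fun p => if p.1 = k then p.2 else a).Perm
      ((l.filter fun p => decide (p.1 = k)).map Prod.snd ++
        List.replicate (l.length - l.countP fun p => decide (p.1 = k)) a) := by
  have h := (List.filter_append_perm (fun p : β × α => decide (p.1 = k)) l).map
    (fun p => if p.1 = k then p.2 else a)
  refine h.symm.trans (List.Perm.of_eq ?_)
  rw [List.map_append]
  congr 1
  · refine List.map_congr_left fun p hp => ?_
    have := (List.mem_filter.1 hp).2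
    simp only [decide_eq_true_eq] at this
    simp [this]
  · rw [List.eq_replicate_iff]
    constructor
    · rw [List.length_map, ← List.countP_eq_length_filter]
      have := List.length_eq_countP_add_countP (fun p : β × α => decide (p.1 = k)) (l := l)
      have e : l.countP (fun p : β × α => !decide (p.1 = k)) =
        l.countP (fun p : β × α => decide (¬ (decide (p.1 = k) = true))) := by
        congr 1; funext p; simp
      omega
    · intro b hb
      obtain ⟨p, hp, rfl⟩ := List.mem_map.1 hb
      have := (List.mem_filter.1 hp).2
      simp at this
      simp [this]

end Bookkeeping

theorem generalized_xiao_mixed_volume (m n : ℕ) (hm : 1 ≤ m) (hn : 2 ≤ n)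
    (i : Fin m → ℕ) (hi : ∑ k, i k ≤ n)
    (A : Set (EuclideanSpace ℝ (Fin n))) (B : Fin m → Set (EuclideanSpace ℝ (Fin n)))
    (K : Fin (n - ∑ k, i k) → Set (EuclideanSpace ℝ (Fin n)))
    (hA : IsConvexBody A) (hB : ∀ k, IsConvexBody (B k)) (hK : ∀ l, IsConvexBody (K l)) :
    ((n.factorial : ℝ) /
        (((∏ k, (i k).factorial) * (n - ∑ k, i k).factorial : ℕ) : ℝ)) *
      (volume A).toReal ^ m *
      mixedVolume (fun j : Fin n => (blocks i B ++ List.ofFn K).getD (j : ℕ) ∅) ≤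
    (n.choose (∑ k, i k) : ℝ) *
      mixedVolume (fun j : Fin n =>
        (List.ofFn K ++ List.replicate (∑ k, i k) A).getD (j : ℕ) ∅) *
      ∏ k, ((n.choose (i k) : ℝ) *
        mixedVolume (fun j : Fin n => if (j : ℕ) < i k then B k else A)) := by
  classical
  set l := labelled i B K with hl
  have hlen : l.length = n := by rw [hl, labelled_length]; omega
  have hsnd : l.map Prod.snd = blocks i B ++ List.ofFn K := labelled_snd i B K
  let q : Fin n → Fin (m + 1) × Set (EuclideanSpace ℝ (Fin n)) := fun j => l.getD (j : ℕ) (0, ∅)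
  have hq : List.ofFn q = l := ofFn_getD hlen _
  have hqmem : ∀ j, q j ∈ l := fun j => by
    rw [← hq]; exact List.mem_ofFn.2 ⟨j, rfl⟩
  have hbody : ∀ j, IsConvexBody (q j).2 := fun j => by
    rcases labelled_mem i B K (hqmem j) with ⟨k, hk⟩ | ⟨r, hr⟩
    · rw [hk]; exact hB k
    · rw [hr]; exact hK r
  have hmain := main_gen (by omega) (fun j => (q j).1) (by simp; omega) hA hbody
  have hcard : ∀ k, Fintype.card {j // (q j).1 = k} = l.countP (fun p => decide (p.1 = k)) := by
    intro k
    rw [card_fiber_ofFn q (fun p => p.1 = k), hq]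
  have hcz : l.countP (fun p => decide (p.1 = 0)) = n - (∑ k, i k) := by
    rw [List.countP_eq_length_filter, hl, labelled_filter_zero, List.length_ofFn]
  have hik : ∀ k, i k ≤ n := fun k =>
    (Finset.single_le_sum (f := i) (fun _ _ => Nat.zero_le _) (Finset.mem_univ k)).trans hi
  -- the mixed volume on the left
  have hV : mixedVolume (fun j => (q j).2) =
      mixedVolume (fun j : Fin n => (blocks i B ++ List.ofFn K).getD (j : ℕ) ∅) := by
    apply mixedVolume_of_perm
    rw [ofFn_getD (by rw [← hsnd, List.length_map, hlen]), ← hsnd, ← hq, List.map_ofFn]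
    rfl
  have hofk : ∀ k, List.ofFn (fun j => if (q j).1 = k then (q j).2 else A) =
      l.map (fun p => if p.1 = k then p.2 else A) := fun k => by
    rw [← hq, List.map_ofFn]; rfl
  have hV0 : mixedVolume (fun j => if (q j).1 = 0 then (q j).2 else A) =
      mixedVolume (fun j : Fin n => (List.ofFn K ++ List.replicate (∑ k, i k) A).getD (j : ℕ) ∅) := by
    apply mixedVolume_of_perm
    rw [ofFn_getD (by rw [List.length_append, List.length_ofFn, List.length_replicate]; omega), hofk]
    refine (map_ite_perm l 0 A).trans (List.Perm.of_eq ?_)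
    rw [hcz, hlen, hl, labelled_filter_zero, List.map_ofFn]
    congr 2
    omega
  have hVk : ∀ k : Fin m, mixedVolume (fun j => if (q j).1 = k.succ then (q j).2 else A) =
      mixedVolume (fun j : Fin n => if (j : ℕ) < i k then B k else A) := fun k => by
    apply mixedVolume_of_perm
    rw [hofk, ofFn_ite (hik k)]
    refine (map_ite_perm l k.succ A).trans (List.Perm.of_eq ?_)
    rw [hl, labelled_count_succ, ← hl, hlen]
    congr 1
    rw [List.eq_replicate_iff]
    constructor
    · rw [List.length_map, ← List.countP_eq_length_filter, hl, labelled_count_succ]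
    · intro b hb
      obtain ⟨p, hp, rfl⟩ := List.mem_map.1 hb
      obtain ⟨hp1, hp2⟩ := List.mem_filter.1 hp
      simp only [decide_eq_true_eq] at hp2
      rcases labelled_mem i B K hp1 with ⟨k', hk⟩ | ⟨r, hr⟩
      · rw [hk] at hp2 ⊢
        have : k' = k := Fin.succ_injective _ hp2
        rw [this]
      · rw [hr] at hp2
        exact absurd hp2.symm (Fin.succ_ne_zero k)
  rw [Fin.prod_univ_succ, hV, hV0] at hmain
  simp only [hVk, hcard, hcz, Fintype.card_fin, Nat.add_sub_cancel] at hmain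
  simp only [hl, labelled_count_succ] at hmain
  have hnI : n - (n - (∑ k, i k)) = (∑ k, i k) := by omega
  rw [hnI] at hmain
  have hch : ∀ k ≤ n, (n.choose k : ℝ) = n.factorial / (k.factorial * (n - k).factorial) := fun k hk =>
    Nat.cast_choose ℝ hk
  have hprod : ∏ k, ((n.choose (i k) : ℝ) *
      mixedVolume (fun j : Fin n => if (j : ℕ) < i k then B k else A)) =
      (∏ k, ((n.factorial * mixedVolume (fun j : Fin n => if (j : ℕ) < i k then B k else A)) /
        ((n - i k).factorial : ℝ))) / ∏ k, ((i k).factorial : ℝ) := by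
    rw [← Finset.prod_div_distrib]
    refine Finset.prod_congr rfl fun k _ => ?_
    rw [hch _ (hik k)]
    have h1 : ((i k).factorial : ℝ) ≠ 0 := by positivity
    have h2 : ((n - i k).factorial : ℝ) ≠ 0 := by positivity
    field_simp
  rw [hprod, hch (∑ k, i k) hi]
  push_cast
  have hF : 0 < ∏ k, ((i k).factorial : ℝ) := Finset.prod_pos fun k _ => by positivity
  have hG : 0 < ((n - (∑ k, i k)).factorial : ℝ) := by positivity
  have hH : 0 < ((∑ k, i k).factorial : ℝ) := by positivity
  have := div_le_div_of_nonneg_right hmain (mul_pos hF hG).le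
  refine (le_of_eq ?_).trans (this.trans (le_of_eq ?_))
  · field_simp
  · field_simp
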